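/- arXiv:1409.1869 — 3 statements merged into one kernel-verified Lean document; each statement's English description precedes it below -/
import Mathlib

section
/- Let ρ be a Schwartz function on ℝ with ∫ρ = 1 and all higher moments ∫ρ(t) t^k dt = 0 (k ≥ 1), and let ρ_T(t) = Tρ(Tt). Suppose N: ℝ → ℝ is a function of locally bounded variation supported in [0,∞), let a_0,…,a_d ∈ ℝ, and let ν_1, ν_2 ∈ ℝ, C_1, C_2 ≥ 0 be such that |N(λ) − H(λ) Σ_{i=0}^d a_i λ^{d-i}| ≤ C_1 (1+|λ|)^{ν_1} + C_2 (1+|λ|)^{ν_2} for all λ, where H is the Heaviside function. Then there is a constant C > 0, depending only on ρ, ν_1, ν_2, and the a_i (not on N, C_1, C_2), such that for all T ≥ 1 and λ ≥ 0: |∫_{-∞}^λ (N(μ) − (N ∗ ρ_T)(μ)) dμ| ≤ (C/T)(C_1 (1+λ)^{ν_1} + C_2 (1+λ)^{ν_2} + 1). -/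
open MeasureTheory

/-- Peetre-type comparison: real powers of two comparable positive numbers are comparable. -/
theorem rpow_le_rpow_mul_pow_of_comparable {a b c ν : ℝ} {M : ℕ} (ha : 0 < a) (hb : 0 < b)
    (hc : 1 ≤ c) (hab : a ≤ b * c) (hba : b ≤ a * c) (hM : |ν| ≤ M) :
    a ^ ν ≤ b ^ ν * c ^ M := by
  have hc0 : 0 < c := by linarith
  have key : a ^ ν ≤ b ^ ν * c ^ |ν| := by
    rcases le_total 0 ν with h | h
    · rw [abs_of_nonneg h, ← Real.mul_rpow hb.le hc0.le]
      exact Real.rpow_le_rpow ha.le hab h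
    · rw [abs_of_nonpos h, Real.rpow_neg hc0.le, ← div_eq_mul_inv,
        ← Real.div_rpow hb.le hc0.le]
      exact Real.rpow_le_rpow_of_nonpos (by positivity) ((div_le_iff₀ hc0).2 hba) h
  refine key.trans (mul_le_mul_of_nonneg_left ?_ (by positivity))
  rw [← Real.rpow_natCast]
  exact Real.rpow_le_rpow_of_exponent_le hc hM

/-- A Schwartz function is integrable against every power of `1 + |s|`. -/
theorem SchwartzMap.integrable_one_add_abs_pow_mul (ρ : SchwartzMap ℝ ℝ) (M : ℕ) :
    Integrable (fun s : ℝ => (1 + |s|) ^ M * |ρ s|) := by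
  have : (fun s : ℝ => (1 + |s|) ^ M * |ρ s|) =
      fun s => ∑ k ∈ Finset.range (M + 1), (M.choose k : ℝ) * (‖s‖ ^ k * ‖ρ s‖) := by
    ext s
    rw [add_comm, add_pow, Finset.sum_mul]
    refine Finset.sum_congr rfl fun k _ => ?_
    simp only [one_pow, Real.norm_eq_abs]
    ring
  rw [this]
  exact integrable_finsetSum _ fun k _ => (ρ.integrable_pow_mul volume k).const_mul _

/-- A measurable function of polynomial growth is integrable against a Schwartz function. -/
theorem SchwartzMap.integrable_mul_of_abs_le (ρ : SchwartzMap ℝ ℝ) {g : ℝ → ℝ}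
    (hg : AEStronglyMeasurable g) {K : ℝ} {M : ℕ} (hK : ∀ s, |g s| ≤ K * (1 + |s|) ^ M) :
    Integrable (fun s => g s * ρ s) := by
  refine ((ρ.integrable_one_add_abs_pow_mul M).const_mul K).mono'
    (hg.mul ρ.continuous.aestronglyMeasurable) (ae_of_all _ fun s => ?_)
  rw [norm_mul, Real.norm_eq_abs, Real.norm_eq_abs, ← mul_assoc]
  exact mul_le_mul_of_nonneg_right (hK s) (abs_nonneg _)

theorem Polynomial.exists_abs_eval_le (p : Polynomial ℝ) :
    ∃ K, 0 ≤ K ∧ ∀ x : ℝ, |p.eval x| ≤ K * (1 + |x|) ^ p.natDegree := by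
  refine ⟨∑ i ∈ Finset.range (p.natDegree + 1), |p.coeff i|,
    Finset.sum_nonneg fun _ _ => abs_nonneg _, fun x => ?_⟩
  rw [Polynomial.eval_eq_sum_range, Finset.sum_mul]
  refine (Finset.abs_sum_le_sum_abs _ _).trans (Finset.sum_le_sum fun i hi => ?_)
  rw [abs_mul, abs_pow]
  refine mul_le_mul_of_nonneg_left ?_ (abs_nonneg _)
  calc |x| ^ i ≤ (1 + |x|) ^ i := by gcongr; linarith
    _ ≤ (1 + |x|) ^ p.natDegree :=
      pow_le_pow_right₀ (by linarith [abs_nonneg x]) (by simpa [Nat.lt_succ_iff] using hi)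

theorem SchwartzMap.integrable_eval_mul (ρ : SchwartzMap ℝ ℝ) (p : Polynomial ℝ) :
    Integrable (fun s => p.eval s * ρ s) := by
  obtain ⟨K, -, hK⟩ := p.exists_abs_eval_le
  exact ρ.integrable_mul_of_abs_le p.continuous.aestronglyMeasurable hK

/-- Integration against a kernel with unit mass and vanishing moments evaluates polynomials
at the origin. -/
theorem SchwartzMap.integral_eval_mul_of_moments (ρ : SchwartzMap ℝ ℝ)
    (hρ1 : (∫ t : ℝ, ρ t) = 1) (hρk : ∀ k : ℕ, 1 ≤ k → (∫ t : ℝ, ρ t * t ^ k) = 0)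
    (p : Polynomial ℝ) : ∫ s, p.eval s * ρ s = p.eval 0 := by
  induction p using Polynomial.induction_on' with
  | add p q hp hq =>
    simp only [Polynomial.eval_add, add_mul]
    rw [integral_add (ρ.integrable_eval_mul p) (ρ.integrable_eval_mul q), hp, hq]
  | monomial n c =>
    simp only [Polynomial.eval_monomial]
    have h : ∫ s, c * s ^ n * ρ s = c * ∫ s, ρ s * s ^ n := by
      rw [← integral_const_mul]
      congr 1
      ext s
      ring
    rw [h]
    rcases Nat.eq_zero_or_pos n with rfl | hn
    · simp [hρ1]
    · simp [hρk n hn, hn.ne']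

theorem integrableOn_Iic_of_zero_on_neg {N : ℝ → ℝ} (hN : Measurable N)
    (hneg : ∀ x < 0, N x = 0) {K : ℝ} {M : ℕ} (hb : ∀ x, |N x| ≤ K * (1 + |x|) ^ M) (y : ℝ) :
    IntegrableOn N (Set.Iic y) := by
  have hK : 0 ≤ K := by simpa using (abs_nonneg _).trans (hb 0)
  have h : IntegrableOn N (Set.Icc 0 y) := by
    refine Measure.integrableOn_of_bounded (M := K * (1 + |y|) ^ M) (by simp)
      hN.aestronglyMeasurable ?_
    refine (ae_restrict_iff' measurableSet_Icc).2 (ae_of_all _ fun x hx => (hb x).trans ?_)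
    have : |x| ≤ |y| := abs_le_abs_of_nonneg hx.1 hx.2
    gcongr
  refine h.of_forall_sdiff_eq_zero measurableSet_Iic fun x hx => hneg x ?_
  by_contra! h0
  exact hx.2 ⟨h0, hx.1⟩

theorem abs_setIntegral_Iic_le_of_zero_on_neg {N : ℝ → ℝ} (hneg : ∀ x < 0, N x = 0) {K : ℝ}
    {M : ℕ} (hb : ∀ x, |N x| ≤ K * (1 + |x|) ^ M) (y : ℝ) :
    |∫ x in Set.Iic y, N x| ≤ K * (1 + |y|) ^ (M + 1) := by
  have hK : 0 ≤ K := by simpa using (abs_nonneg _).trans (hb 0)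
  have h : ∫ x in Set.Iic y, N x = ∫ x in Set.Icc 0 y, N x := by
    refine setIntegral_eq_of_subset_of_forall_sdiff_eq_zero measurableSet_Iic
      Set.Icc_subset_Iic_self fun x hx => hneg x ?_
    by_contra! h0
    exact hx.2 ⟨h0, hx.1⟩
  rw [h]
  have := norm_setIntegral_le_of_norm_le_const (μ := volume) (s := Set.Icc 0 y) (f := N)
    (C := K * (1 + |y|) ^ M) (by simp) (fun x hx => (hb x).trans (by
      have : |x| ≤ |y| := abs_le_abs_of_nonneg hx.1 hx.2
      gcongr))
  refine this.trans ?_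
  rw [pow_succ, ← mul_assoc]
  refine mul_le_mul_of_nonneg_left ?_ (by positivity)
  simp only [measureReal_def, Real.volume_Icc, sub_zero, ENNReal.toReal_ofReal']
  exact max_le (by linarith [le_abs_self y]) (by positivity)

theorem setIntegral_Iic_comp_sub_right (f : ℝ → ℝ) (l c : ℝ) :
    ∫ x in Set.Iic l, f (x - c) = ∫ x in Set.Iic (l - c), f x := by
  have := (measurePreserving_sub_right volume c).setIntegral_preimage_emb
    (measurableEmbedding_subRight c) f (Set.Iic (l - c))
  simpa using this

theorem measurable_setIntegral_Iic {N : ℝ → ℝ} (hN : ∀ y, IntegrableOn N (Set.Iic y)) :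
    Measurable (fun y => ∫ x in Set.Iic y, N x) := by
  have h : (fun y => ∫ x in Set.Iic y, N x) =
      fun y => (∫ x in Set.Iic 0, N x) + ∫ x in (0 : ℝ)..y, N x := by
    ext y
    rw [← intervalIntegral.integral_Iic_sub_Iic (hN 0) (hN y)]
    ring
  rw [h]
  refine (continuous_const.add (intervalIntegral.continuous_primitive (fun a b => ?_) 0)).measurable
  exact ⟨(hN b).mono_set Set.Ioc_subset_Iic_self, (hN a).mono_set Set.Ioc_subset_Iic_self⟩

/-- The integrated mollification error as an average of increments of the primitive of `N`. -/
theorem SchwartzMap.setIntegral_Iic_sub_mollification (ρ : SchwartzMap ℝ ℝ)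
    (hρ1 : (∫ t : ℝ, ρ t) = 1) {N : ℝ → ℝ} (hN : Measurable N) (hneg : ∀ x < 0, N x = 0)
    {K : ℝ} {M : ℕ} (hb : ∀ x, |N x| ≤ K * (1 + |x|) ^ M) (ε l : ℝ) :
    ∫ μ in Set.Iic l, (N μ - ∫ s, N (μ - ε * s) * ρ s) =
      ∫ s, (∫ x in (l - ε * s)..l, N x) * ρ s := by
  have hK : 0 ≤ K := by simpa using (abs_nonneg _).trans (hb 0)
  have hint := integrableOn_Iic_of_zero_on_neg hN hneg hb
  have hgrow : ∀ G : ℝ → ℝ, (∀ y, |G y| ≤ K * (1 + |y|) ^ (M + 1)) → ∀ s,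
      |G (l - ε * s)| ≤ K * ((1 + |l|) * (1 + |ε|)) ^ (M + 1) * (1 + |s|) ^ (M + 1) := by
    intro G hG s
    refine (hG _).trans ?_
    rw [mul_assoc, ← mul_pow]
    have h1 : |l - ε * s| ≤ |l| + |ε| * |s| := (abs_sub _ _).trans (by rw [abs_mul])
    have h2 : 1 + |l - ε * s| ≤ (1 + |l|) * (1 + |ε|) * (1 + |s|) := by
      have := abs_nonneg l
      have := abs_nonneg ε
      have := abs_nonneg s
      have : 0 ≤ |l| * |ε| * |s| := by positivity
      have : 0 ≤ |l| * |ε| := by positivity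
      have : 0 ≤ |l| * |s| := by positivity
      nlinarith
    gcongr
  have hshift : Measurable fun s : ℝ => l - ε * s := by fun_prop
  have hF : Integrable (fun s => (∫ x in Set.Iic (l - ε * s), N x) * ρ s) :=
    ρ.integrable_mul_of_abs_le
      ((measurable_setIntegral_Iic hint).comp hshift).aestronglyMeasurable
      (hgrow _ (abs_setIntegral_Iic_le_of_zero_on_neg hneg hb))
  have hprod : Integrable (fun z : ℝ × ℝ => N (z.1 - ε * z.2) * ρ z.2)
      ((volume.restrict (Set.Iic l)).prod volume) := by
    have hmeas : Measurable fun z : ℝ × ℝ => N (z.1 - ε * z.2) * ρ z.2 :=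
      (hN.comp (by fun_prop)).mul (ρ.continuous.measurable.comp measurable_snd)
    refine (integrable_prod_iff' hmeas.aestronglyMeasurable).2 ⟨ae_of_all _ fun s => ?_, ?_⟩
    · have := ((measurePreserving_sub_right volume (ε * s)).integrableOn_comp_preimage
        (measurableEmbedding_subRight (ε * s))).2 (hint (l - ε * s))
      have hs : Integrable (fun μ => N (μ - ε * s)) (volume.restrict (Set.Iic l)) := by
        simpa [IntegrableOn, Function.comp_def] using this
      exact hs.mul_const (ρ s)
    · have habs : ∀ x, |(|N x|)| ≤ K * (1 + |x|) ^ M := fun x => by simpa using hb x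
      have h := (ρ.integrable_mul_of_abs_le (g := fun s => ∫ x in Set.Iic (l - ε * s), |N x|)
        ((measurable_setIntegral_Iic fun y => (hint y).abs).comp hshift).aestronglyMeasurable
        (hgrow _ (abs_setIntegral_Iic_le_of_zero_on_neg
          (fun x hx => by simp [hneg x hx]) habs))).abs
      refine h.congr (ae_of_all _ fun s => ?_)
      simp only [norm_mul, Real.norm_eq_abs]
      rw [integral_mul_const, setIntegral_Iic_comp_sub_right (fun x => |N x|), abs_mul,
        abs_of_nonneg (integral_nonneg fun x => abs_nonneg _)]
  rw [integral_sub (hint l) hprod.integral_prod_left, integral_integral_swap hprod]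
  simp only [integral_mul_const, setIntegral_Iic_comp_sub_right N]
  have hmass : ∫ x in Set.Iic l, N x = ∫ s, (∫ x in Set.Iic l, N x) * ρ s := by
    rw [integral_const_mul, hρ1, mul_one]
  rw [hmass, ← integral_sub (ρ.integrable.const_mul _) hF]
  congr 1
  ext s
  rw [← sub_mul, intervalIntegral.integral_Iic_sub_Iic (hint _) (hint _)]

theorem measurable_of_boundedVariationOn_Icc {N : ℝ → ℝ}
    (h : ∀ x y : ℝ, BoundedVariationOn N (Set.Icc x y)) : Measurable N := by
  have hloc : LocallyBoundedVariationOn N Set.univ := fun x y _ _ => by simpa using h x y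
  obtain ⟨p, q, hp, hq, rfl⟩ := hloc.exists_monotoneOn_sub_monotoneOn
  exact (monotoneOn_univ.1 hp).measurable.sub (monotoneOn_univ.1 hq).measurable

theorem Polynomial.exists_derivative_eq (p : Polynomial ℝ) :
    ∃ q : Polynomial ℝ, q.derivative = p := by
  induction p using Polynomial.induction_on' with
  | add p₁ p₂ h₁ h₂ =>
    obtain ⟨q₁, rfl⟩ := h₁
    obtain ⟨q₂, rfl⟩ := h₂
    exact ⟨q₁ + q₂, Polynomial.derivative_add⟩
  | monomial n c =>
    refine ⟨Polynomial.monomial (n + 1) (c / (n + 1)), ?_⟩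
    rw [Polynomial.derivative_monomial]
    congr 1
    push_cast
    field_simp

/-- Averages of increments of polynomial primitives against a kernel with vanishing moments
are zero. -/
theorem SchwartzMap.integral_intervalIntegral_eval_mul (ρ : SchwartzMap ℝ ℝ)
    (hρ1 : (∫ t : ℝ, ρ t) = 1) (hρk : ∀ k : ℕ, 1 ≤ k → (∫ t : ℝ, ρ t * t ^ k) = 0)
    (p : Polynomial ℝ) (ε l : ℝ) :
    Integrable (fun s => (∫ x in (l - ε * s)..l, p.eval x) * ρ s) ∧
      ∫ s, (∫ x in (l - ε * s)..l, p.eval x) * ρ s = 0 := by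
  obtain ⟨q, rfl⟩ := p.exists_derivative_eq
  have h : ∀ s, ∫ x in (l - ε * s)..l, q.derivative.eval x =
      (Polynomial.C (q.eval l) -
        q.comp (Polynomial.C l - Polynomial.C ε * Polynomial.X)).eval s := by
    intro s
    rw [intervalIntegral.integral_eq_sub_of_hasDerivAt (fun x _ => q.hasDerivAt x)
      (q.derivative.continuous.intervalIntegrable _ _)]
    simp
  simp only [h]
  exact ⟨ρ.integrable_eval_mul _, by
    rw [ρ.integral_eval_mul_of_moments hρ1 hρk]; simp⟩

/-- Safarov's proposition on integrated mollification errors: if `N` is of locally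
bounded variation, supported in `[0,∞)`, and close to `H(λ) Σ aᵢ λ^{d-i}` with a
two-weight error, then `∫_{-∞}^λ (N − N ∗ ρ_T)` is `O(1/T)` with the same weights. -/
theorem stmt_6 (ρ : SchwartzMap ℝ ℝ)
    (hρ1 : (∫ t : ℝ, ρ t) = 1)
    (hρk : ∀ k : ℕ, 1 ≤ k → (∫ t : ℝ, ρ t * t ^ k) = 0)
    (d : ℕ) (a : Fin (d + 1) → ℝ) (ν₁ ν₂ : ℝ) :
    ∃ C > (0:ℝ), ∀ (N : ℝ → ℝ) (C₁ C₂ : ℝ), 0 ≤ C₁ → 0 ≤ C₂ →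
      (∀ x y : ℝ, BoundedVariationOn N (Set.Icc x y)) →
      (∀ l : ℝ, l < 0 → N l = 0) →
      (∀ l : ℝ, |N l - (if 0 ≤ l then ∑ i : Fin (d + 1), a i * l ^ (d - (i : ℕ)) else 0)|
        ≤ C₁ * (1 + |l|) ^ ν₁ + C₂ * (1 + |l|) ^ ν₂) →
      ∀ T : ℝ, 1 ≤ T → ∀ l : ℝ, 0 ≤ l →
        |∫ μ in Set.Iic l, (N μ - ∫ t : ℝ, N (μ - t) * (T * ρ (T * t)))|
          ≤ C / T * (C₁ * (1 + l) ^ ν₁ + C₂ * (1 + l) ^ ν₂ + 1) := by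
  obtain ⟨p, hp⟩ : ∃ p : Polynomial ℝ, ∀ x, p.eval x =
      ∑ i : Fin (d + 1), a i * x ^ (d - (i : ℕ)) :=
    ⟨∑ i : Fin (d + 1), Polynomial.C (a i) * Polynomial.X ^ (d - (i : ℕ)), fun x => by
      simp [Polynomial.eval_finsetSum]⟩
  simp only [← hp]
  obtain ⟨A, hA, hpA⟩ := p.exists_abs_eval_le
  obtain ⟨M, hM⟩ := exists_nat_ge (max (p.natDegree : ℝ) (max |ν₁| |ν₂|))
  have hMp : p.natDegree ≤ M := by exact_mod_cast (le_max_left _ _).trans hM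
  have hM₁ : |ν₁| ≤ M := (le_max_left _ _).trans ((le_max_right _ _).trans hM)
  have hM₂ : |ν₂| ≤ M := (le_max_right _ _).trans ((le_max_right _ _).trans hM)
  have hpM : ∀ x, |p.eval x| ≤ A * (1 + |x|) ^ M := fun x => (hpA x).trans
    (mul_le_mul_of_nonneg_left
      (pow_le_pow_right₀ (by linarith [abs_nonneg x]) hMp) hA)
  set I : ℝ := ∫ s, (1 + |s|) ^ (M + 1) * |ρ s| with hI
  have hI0 : 0 ≤ I := integral_nonneg fun s => by positivity
  refine ⟨(1 + A) * I + 1, by positivity, ?_⟩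
  intro N C₁ C₂ hC₁ hC₂ hBV hneg herr T hT l hl
  have hT0 : 0 < T := by linarith
  have hNm := measurable_of_boundedVariationOn_Icc hBV
  set W : ℝ := C₁ * (1 + l) ^ ν₁ + C₂ * (1 + l) ^ ν₂ + 1 with hW
  have hW1 : 1 ≤ W := by
    have : 0 ≤ C₁ * (1 + l) ^ ν₁ := by positivity
    have : 0 ≤ C₂ * (1 + l) ^ ν₂ := by positivity
    linarith
  -- the weights at `x` are controlled by those at any `y ≥ 0`
  have hweight : ∀ x y r : ℝ, 0 ≤ y → |x - y| ≤ r → C₁ * (1 + |x|) ^ ν₁ + C₂ * (1 + |x|) ^ ν₂ ≤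
      (C₁ * (1 + y) ^ ν₁ + C₂ * (1 + y) ^ ν₂) * (1 + r) ^ M := by
    intro x y r hy hxy
    have hr : 0 ≤ r := (abs_nonneg _).trans hxy
    have hx := abs_nonneg x
    have h1 : |x| ≤ y + r := by
      have := abs_add_le (x - y) y
      rw [sub_add_cancel, abs_of_nonneg hy] at this
      linarith
    have h2 : y ≤ |x| + r := by
      have := neg_abs_le (x - y)
      have := le_abs_self x
      linarith
    have hA₁ : 1 + |x| ≤ (1 + y) * (1 + r) := by nlinarith [mul_nonneg hy hr]
    have hA₂ : 1 + y ≤ (1 + |x|) * (1 + r) := by nlinarith [mul_nonneg hx hr]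
    have e₁ := rpow_le_rpow_mul_pow_of_comparable (a := 1 + |x|) (by positivity) (by positivity)
      (by linarith) hA₁ hA₂ hM₁
    have e₂ := rpow_le_rpow_mul_pow_of_comparable (a := 1 + |x|) (by positivity) (by positivity)
      (by linarith) hA₁ hA₂ hM₂
    rw [add_mul, mul_assoc, mul_assoc]
    gcongr
  have hNb : ∀ x, |N x| ≤ (A + C₁ + C₂) * (1 + |x|) ^ M := by
    intro x
    have h1 := herr x
    have h2 := hweight x 0 |x| le_rfl (by simp)
    simp only [add_zero, Real.one_rpow, mul_one] at h2
    have h3 := hpM x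
    rcases lt_or_ge x 0 with hx | hx
    · rw [hneg x hx, abs_zero]
      positivity
    · rw [if_pos hx] at h1
      have := abs_sub_abs_le_abs_sub (N x) (p.eval x)
      linarith
  have hscale : ∀ μ, ∫ t : ℝ, N (μ - t) * (T * ρ (T * t)) = ∫ s, N (μ - T⁻¹ * s) * ρ s := by
    intro μ
    have h := Measure.integral_comp_mul_left (fun s => N (μ - T⁻¹ * s) * ρ s) T
    rw [abs_of_pos (by positivity), smul_eq_mul, inv_mul_eq_div, eq_div_iff hT0.ne', mul_comm,
      ← integral_const_mul] at h
    rw [← h]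
    congr 1
    ext t
    rw [inv_mul_cancel_left₀ hT0.ne']
    ring
  simp only [hscale]
  rw [ρ.setIntegral_Iic_sub_mollification hρ1 hNm hneg hNb]
  obtain ⟨hpint, hpzero⟩ := ρ.integral_intervalIntegral_eval_mul hρ1 hρk p T⁻¹ l
  have hNint : ∀ u v, IntervalIntegrable N volume u v := fun u v =>
    ⟨(integrableOn_Iic_of_zero_on_neg hNm hneg hNb v).mono_set Set.Ioc_subset_Iic_self,
      (integrableOn_Iic_of_zero_on_neg hNm hneg hNb u).mono_set Set.Ioc_subset_Iic_self⟩
  have hbound : ∀ s, |∫ x in (l - T⁻¹ * s)..l, (N x - p.eval x)| ≤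
      (1 + A) / T * W * (1 + |s|) ^ (M + 1) := by
    intro s
    have hTi : T⁻¹ ≤ 1 := inv_le_one_of_one_le₀ hT
    have habs : |T⁻¹ * s| ≤ |s| := by
      rw [abs_mul, abs_of_pos (by positivity)]
      exact mul_le_of_le_one_left (abs_nonneg _) hTi
    have h := intervalIntegral.norm_integral_le_of_norm_le_const (a := l - T⁻¹ * s) (b := l)
      (f := fun x => N x - p.eval x) (C := (1 + A) * W * (1 + |s|) ^ M) (fun x hx => by
        have hxl : |x - l| ≤ |s| := by
          have := Set.abs_sub_right_of_mem_uIcc (Set.uIoc_subset_uIcc hx)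
          rw [abs_sub_comm]
          exact this.trans (by simpa using habs)
        have h1 := herr x
        have h2 := hweight x l |s| hl hxl
        have hS : 0 ≤ (1 + |s|) ^ M := by positivity
        have hAW : 0 ≤ A * W * (1 + |s|) ^ M := by positivity
        rw [Real.norm_eq_abs]
        rcases lt_or_ge x 0 with hx0 | hx0
        · have hxs : |x| ≤ |s| := by
            refine le_trans ?_ hxl
            rw [abs_of_neg hx0, abs_of_neg (by linarith)]
            linarith
          rw [hneg x hx0, zero_sub, abs_neg]
          calc |p.eval x| ≤ A * (1 + |x|) ^ M := hpM x
            _ ≤ A * (1 + |s|) ^ M := by gcongr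
            _ ≤ (1 + A) * W * (1 + |s|) ^ M := by
              gcongr
              nlinarith
        · rw [if_pos hx0] at h1
          have : (C₁ * (1 + l) ^ ν₁ + C₂ * (1 + l) ^ ν₂) * (1 + |s|) ^ M ≤
              W * (1 + |s|) ^ M := by
            gcongr
            linarith
          linarith)
    refine h.trans ?_
    rw [sub_sub_cancel, abs_mul, abs_of_pos (by positivity : 0 < T⁻¹)]
    calc (1 + A) * W * (1 + |s|) ^ M * (T⁻¹ * |s|)
        ≤ (1 + A) * W * (1 + |s|) ^ M * (T⁻¹ * (1 + |s|)) := by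
          gcongr
          linarith
      _ = (1 + A) / T * W * (1 + |s|) ^ (M + 1) := by
          rw [pow_succ]
          ring
  have hsplit : ∫ s, (∫ x in (l - T⁻¹ * s)..l, N x) * ρ s =
      ∫ s, (∫ x in (l - T⁻¹ * s)..l, (N x - p.eval x)) * ρ s := by
    have hEint : Integrable (fun s => (∫ x in (l - T⁻¹ * s)..l, (N x - p.eval x)) * ρ s) := by
      refine ρ.integrable_mul_of_abs_le ?_ hbound
      have hc := intervalIntegral.continuous_primitive (μ := volume)
        (fun u v => (hNint u v).sub (p.continuous.intervalIntegrable u v)) l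
      have h : (fun s => ∫ x in (l - T⁻¹ * s)..l, (N x - p.eval x)) =
          fun s => -∫ x in l..(l - T⁻¹ * s), (N x - p.eval x) := by
        ext s
        exact intervalIntegral.integral_symm _ _
      rw [h]
      exact (hc.comp (by fun_prop : Continuous fun s : ℝ => l - T⁻¹ * s)).neg.aestronglyMeasurable
    have hadd := integral_add hEint hpint
    rw [hpzero, add_zero] at hadd
    rw [← hadd]
    congr 1
    ext s
    rw [← add_mul, intervalIntegral.integral_sub (hNint _ _)
      (p.continuous.intervalIntegrable _ _), sub_add_cancel]
  rw [hsplit]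
  calc |∫ s, (∫ x in (l - T⁻¹ * s)..l, (N x - p.eval x)) * ρ s|
      ≤ ∫ s, (1 + A) / T * W * ((1 + |s|) ^ (M + 1) * |ρ s|) := by
        rw [← Real.norm_eq_abs]
        refine norm_integral_le_of_norm_le
          ((ρ.integrable_one_add_abs_pow_mul (M + 1)).const_mul _) (ae_of_all _ fun s => ?_)
        rw [norm_mul, Real.norm_eq_abs, Real.norm_eq_abs, ← mul_assoc]
        exact mul_le_mul_of_nonneg_right (hbound s) (abs_nonneg _)
    _ = (1 + A) * I / T * W := by
        rw [integral_const_mul, ← hI]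
        ring
    _ ≤ ((1 + A) * I + 1) / T * W := by
        gcongr
        linarith
end

section
/- Let ρ be an even Schwartz function with ρ̂ supported in [-1,1], ρ̂ = 1 near 0, and fix ε > 0 and an integer k ≥ 1. Let N: ℝ → ℝ be a nondecreasing function supported in [0,∞) of polynomial growth, and define N^{odd}(λ) = N(λ) − N(−λ). Then for every c > 0, (N ∗ (χ_+^{k-1} ∗ (ρ_T − ρ_ε)))(λ) − (N^{odd} ∗ (χ_+^{k-1} ∗ (ρ_T − ρ_ε)))(λ) = O(e^{cT} λ^{-∞}) as λ → +∞, uniformly in T ≥ 1. -/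
open MeasureTheory

/-- The Fourier transform with convention `f̂(ξ) = ∫ f(t) e^{-itξ} dt`. -/
noncomputable def FT (f : ℝ → ℂ) (ξ : ℝ) : ℂ :=
  ∫ t : ℝ, f t * Complex.exp (-(Complex.I * t * ξ))

open scoped FourierTransform Real Topology

/-- The mass-preserving dilation `ρ_S(u) = S ρ(S u)`. -/
noncomputable def dilation (ρ : ℝ → ℝ) (S u : ℝ) : ℝ := S * ρ (S * u)

/-- The convolution `χ₊^j ∗ (ρ_T − ρ_ε)`, where `χ₊^j(r) = r₊^j / j!`. -/
noncomputable def truncatedKernel (ρ : ℝ → ℝ) (ε : ℝ) (j : ℕ) (T x : ℝ) : ℝ :=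
  ∫ r in Set.Ioi (0:ℝ), r ^ j / (Nat.factorial j : ℝ) *
    (T * ρ (T * (x - r)) - ε * ρ (ε * (x - r)))

lemma FT_eq_fourier (f : ℝ → ℂ) (ξ : ℝ) : FT f (2 * π * ξ) = 𝓕 f ξ := by
  rw [Real.fourier_real_eq_integral_exp_smul, FT]
  congr 1 with t
  rw [smul_eq_mul, mul_comm]
  congr 2
  push_cast
  ring

lemma integrable_inv_one_add_abs_sq : Integrable fun r : ℝ => ((1 + |r|) ^ 2)⁻¹ := by
  have h := integrable_one_add_norm (E := ℝ) (μ := volume) (r := 2) (by simp)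
  refine h.congr (.of_forall fun r => ?_)
  have : 0 ≤ 1 + |r| := by positivity
  simp only [Real.norm_eq_abs, Real.rpow_neg this, Real.rpow_ofNat]

namespace SchwartzMap

lemma integrable_pow_mul_real (ρ : SchwartzMap ℝ ℝ) (n : ℕ) :
    Integrable fun t : ℝ => t ^ n * ρ t := by
  refine (ρ.integrable_pow_mul volume n).mono
    (by have := ρ.continuous; exact Continuous.aestronglyMeasurable (by fun_prop))
    (.of_forall fun t => ?_)
  simp

lemma integrable_eval_mul_s13 (ρ : SchwartzMap ℝ ℝ) (Q : Polynomial ℝ) :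
    Integrable fun t : ℝ => Q.eval t * ρ t := by
  induction Q using Polynomial.induction_on' with
  | add p q hp hq =>
    simp only [Polynomial.eval_add, add_mul]
    exact hp.add hq
  | monomial n a => simpa [mul_assoc] using (ρ.integrable_pow_mul_real n).const_mul a

lemma integral_pow_mul_eq (ρ : SchwartzMap ℝ ℝ)
    (hone : ∃ δ > (0:ℝ), ∀ ξ : ℝ, |ξ| < δ → FT (fun t => (ρ t : ℂ)) ξ = 1) (n : ℕ) :
    ∫ t : ℝ, t ^ n * ρ t = if n = 0 then 1 else 0 := by
  obtain ⟨δ, hδ, h⟩ := hone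
  have hloc : 𝓕 (fun t => (ρ t : ℂ)) =ᶠ[𝓝 0] fun _ => 1 := by
    have hc : Filter.Tendsto (fun ξ : ℝ => |2 * π * ξ|) (𝓝 0) (𝓝 0) := by
      have : Continuous fun ξ : ℝ => |2 * π * ξ| := by fun_prop
      simpa using this.tendsto 0
    filter_upwards [hc.eventually (gt_mem_nhds hδ)] with ξ hξ
    rw [← FT_eq_fourier, h _ hξ]
  have hint : ∀ m : ℕ, (m : ℕ∞) ≤ ⊤ → Integrable fun t : ℝ => t ^ m • (ρ t : ℂ) := by
    intro m _
    refine (ρ.integrable_pow_mul_real m).ofReal.congr (.of_forall fun t => ?_)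
    simp
  have hder := congrFun (Real.iteratedDeriv_fourier hint (n := n) le_top) 0
  rw [hloc.iteratedDeriv_eq, iteratedDeriv_const, ← FT_eq_fourier, FT] at hder
  have hval : ∫ t : ℝ, ((-2 * π * Complex.I * t) ^ n • (ρ t : ℂ)) *
        Complex.exp (-(Complex.I * t * ((2 * π * 0 : ℝ) : ℂ)))
      = (-2 * π * Complex.I) ^ n * ((∫ t : ℝ, t ^ n * ρ t : ℝ) : ℂ) := by
    rw [← integral_complex_ofReal, ← integral_const_mul]
    congr 1 with t
    simp
    ring
  rw [hval] at hder
  rcases eq_or_ne n 0 with rfl | hn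
  · simpa using (Complex.ofReal_injective (by simpa using hder)).symm
  · simp only [hn, if_false] at hder ⊢
    have hne : (-2 * π * Complex.I : ℂ) ^ n ≠ 0 := by
      simp [Real.pi_ne_zero]
    exact_mod_cast (mul_eq_zero.1 hder.symm).resolve_left hne

lemma integral_eval_mul (ρ : SchwartzMap ℝ ℝ)
    (hone : ∃ δ > (0:ℝ), ∀ ξ : ℝ, |ξ| < δ → FT (fun t => (ρ t : ℂ)) ξ = 1)
    (Q : Polynomial ℝ) : ∫ t : ℝ, Q.eval t * ρ t = Q.eval 0 := by
  induction Q using Polynomial.induction_on' with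
  | add p q hp hq =>
    simp only [Polynomial.eval_add, add_mul]
    rw [integral_add (ρ.integrable_eval_mul_s13 p) (ρ.integrable_eval_mul_s13 q), hp, hq]
  | monomial n a =>
    simp only [Polynomial.eval_monomial, mul_assoc]
    rw [integral_const_mul, ρ.integral_pow_mul_eq hone]
    rcases eq_or_ne n 0 with rfl | hn <;> simp [*]

lemma pow_mul_dilation_eq (ρ : ℝ → ℝ) (j : ℕ) {S : ℝ} (hS : 0 < S) (x r : ℝ) :
    r ^ j * dilation ρ S (x - r) =
      S * (((Polynomial.C x - Polynomial.C S⁻¹ * Polynomial.X) ^ j).eval (S * (x - r)) *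
        ρ (S * (x - r))) := by
  have : x - S⁻¹ * (S * (x - r)) = r := by field_simp; ring
  simp only [dilation, Polynomial.eval_pow, Polynomial.eval_sub, Polynomial.eval_mul,
    Polynomial.eval_C, Polynomial.eval_X, this]
  ring

lemma integrable_pow_mul_dilation (ρ : SchwartzMap ℝ ℝ) (j : ℕ) {S : ℝ} (hS : 0 < S) (x : ℝ) :
    Integrable fun r : ℝ => r ^ j * dilation ρ S (x - r) := by
  simp only [pow_mul_dilation_eq _ j hS]
  exact (((ρ.integrable_eval_mul_s13 _).comp_mul_left' hS.ne').comp_sub_left x).const_mul S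

lemma integral_pow_mul_dilation (ρ : SchwartzMap ℝ ℝ)
    (hone : ∃ δ > (0:ℝ), ∀ ξ : ℝ, |ξ| < δ → FT (fun t => (ρ t : ℂ)) ξ = 1)
    (j : ℕ) {S : ℝ} (hS : 0 < S) (x : ℝ) :
    ∫ r : ℝ, r ^ j * dilation ρ S (x - r) = x ^ j := by
  simp only [pow_mul_dilation_eq _ j hS]
  set Q := (Polynomial.C x - Polynomial.C S⁻¹ * Polynomial.X) ^ j with hQ
  rw [integral_const_mul,
    integral_sub_left_eq_self (fun u => Q.eval (S * u) * ρ (S * u)) volume x,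
    Measure.integral_comp_mul_left (fun u => Q.eval u * ρ u) S, ρ.integral_eval_mul hone,
    abs_of_pos (inv_pos.2 hS), smul_eq_mul, mul_inv_cancel_left₀ hS.ne', hQ]
  simp

lemma exists_dilation_decay (ρ : SchwartzMap ℝ ℝ) {a : ℝ} (ha : 0 < a) (M : ℕ) :
    ∃ C, 0 ≤ C ∧ ∀ S, a ≤ S → ∀ u, (1 + |u|) ^ M * |dilation ρ S u| ≤ C * S := by
  obtain ⟨C, hC⟩ : ∃ C, ∀ u, (1 + |u|) ^ M * |ρ u| ≤ C := ⟨_, fun u => by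
    simpa using ρ.one_add_le_sup_seminorm_apply (𝕜 := ℝ) (m := (M, 0)) le_rfl le_rfl u⟩
  have hC0 : 0 ≤ C := le_trans (by positivity) (hC 0)
  refine ⟨(1 + a⁻¹) ^ M * C, by positivity, fun S hS u => ?_⟩
  have hS0 : 0 < S := ha.trans_le hS
  have hu : 1 + |u| ≤ (1 + a⁻¹) * (1 + |S * u|) := by
    have h1 : |u| ≤ a⁻¹ * |S * u| := by
      rw [abs_mul, abs_of_pos hS0, ← mul_assoc]
      refine le_mul_of_one_le_left (abs_nonneg u) ?_
      rw [inv_mul_eq_div]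
      exact (one_le_div ha).2 hS
    nlinarith [abs_nonneg (S * u), inv_pos.2 ha]
  calc (1 + |u|) ^ M * |dilation ρ S u|
      ≤ ((1 + a⁻¹) * (1 + |S * u|)) ^ M * |dilation ρ S u| := by gcongr
    _ = (1 + a⁻¹) ^ M * ((1 + |S * u|) ^ M * |ρ (S * u)|) * S := by
        rw [dilation, abs_mul S (ρ (S * u)), abs_of_pos hS0, mul_pow]; ring
    _ ≤ (1 + a⁻¹) ^ M * C * S := by gcongr; exact hC _

lemma truncatedKernel_eq_neg (ρ : SchwartzMap ℝ ℝ)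
    (hone : ∃ δ > (0:ℝ), ∀ ξ : ℝ, |ξ| < δ → FT (fun t => (ρ t : ℂ)) ξ = 1)
    {ε T : ℝ} (hε : 0 < ε) (hT : 0 < T) (j : ℕ) (x : ℝ) :
    truncatedKernel ρ ε j T x = -∫ r in Set.Iic (0:ℝ), r ^ j / (Nat.factorial j : ℝ) *
      (dilation ρ T (x - r) - dilation ρ ε (x - r)) := by
  have hexp : ∀ r : ℝ, r ^ j / (Nat.factorial j : ℝ) *
      (dilation ρ T (x - r) - dilation ρ ε (x - r)) = (Nat.factorial j : ℝ)⁻¹ *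
        (r ^ j * dilation ρ T (x - r) - r ^ j * dilation ρ ε (x - r)) := fun r => by ring
  have hT' := ρ.integrable_pow_mul_dilation j hT x
  have hε' := ρ.integrable_pow_mul_dilation j hε x
  have hint : Integrable fun r : ℝ => r ^ j / (Nat.factorial j : ℝ) *
      (dilation ρ T (x - r) - dilation ρ ε (x - r)) := by
    simp only [hexp]
    exact (hT'.sub hε').const_mul _
  have hzero : ∫ r : ℝ, r ^ j / (Nat.factorial j : ℝ) *
      (dilation ρ T (x - r) - dilation ρ ε (x - r)) = 0 := by
    simp only [hexp]
    rw [integral_const_mul, integral_sub hT' hε', ρ.integral_pow_mul_dilation hone j hT,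
      ρ.integral_pow_mul_dilation hone j hε, sub_self, mul_zero]
  have hsplit := integral_add_compl (measurableSet_Iic (a := (0:ℝ))) hint
  rw [hzero, Set.compl_Iic] at hsplit
  exact eq_neg_of_add_eq_zero_right hsplit

lemma exists_truncatedKernel_decay (ρ : SchwartzMap ℝ ℝ)
    (hone : ∃ δ > (0:ℝ), ∀ ξ : ℝ, |ξ| < δ → FT (fun t => (ρ t : ℂ)) ξ = 1)
    {ε : ℝ} (hε : 0 < ε) (j m : ℕ) :
    ∃ A, 0 ≤ A ∧ ∀ T, 1 ≤ T → ∀ x, 0 ≤ x →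
      (1 + x) ^ m * |truncatedKernel ρ ε j T x| ≤ A * T := by
  obtain ⟨C, hC0, hC⟩ := ρ.exists_dilation_decay (lt_min one_pos hε) (m + j + 2)
  refine ⟨C * (1 + ε) * ∫ r : ℝ, ((1 + |r|) ^ 2)⁻¹,
    mul_nonneg (by positivity) (integral_nonneg fun r => by positivity), fun T hT x hx => ?_⟩
  have hT0 : 0 < T := one_pos.trans_le hT
  have hpt : ∀ r ∈ Set.Iic (0:ℝ), (1 + x) ^ m * ‖r ^ j / (Nat.factorial j : ℝ) *
      (dilation ρ T (x - r) - dilation ρ ε (x - r))‖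
        ≤ C * (1 + ε) * T * ((1 + |r|) ^ 2)⁻¹ := by
    intro r hr
    have hxr : |x - r| = x + |r| := by
      rw [abs_of_nonpos (Set.mem_Iic.1 hr), abs_of_nonneg] <;> linarith [Set.mem_Iic.1 hr]
    have hD : (1 + |x - r|) ^ (m + j + 2) *
        |dilation ρ T (x - r) - dilation ρ ε (x - r)| ≤ C * (1 + ε) * T := by
      calc _ ≤ (1 + |x - r|) ^ (m + j + 2) *
            (|dilation ρ T (x - r)| + |dilation ρ ε (x - r)|) := by gcongr; exact abs_sub _ _
        _ ≤ C * T + C * ε := by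
            rw [mul_add]
            exact add_le_add (hC T ((min_le_left _ _).trans hT) _) (hC ε (min_le_right _ _) _)
        _ ≤ C * (1 + ε) * T := by nlinarith [mul_nonneg hC0 hε.le]
    have hfac : (1:ℝ) ≤ Nat.factorial j := by exact_mod_cast Nat.factorial_pos j
    rw [← div_eq_mul_inv, le_div_iff₀ (by positivity)]
    refine le_trans ?_ hD
    rw [hxr, Real.norm_eq_abs, abs_mul, abs_div, abs_pow, abs_of_nonneg (zero_le_one.trans hfac)]
    set D := |dilation ρ T (x - r) - dilation ρ ε (x - r)|
    calc (1 + x) ^ m * (|r| ^ j / (Nat.factorial j : ℝ) * D) * (1 + |r|) ^ 2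
        ≤ (1 + x) ^ m * (|r| ^ j * D) * (1 + |r|) ^ 2 := by
          gcongr
          exact div_le_self (by positivity) hfac
      _ = (1 + x) ^ m * |r| ^ j * (1 + |r|) ^ 2 * D := by ring
      _ ≤ (1 + (x + |r|)) ^ m * (1 + (x + |r|)) ^ j * (1 + (x + |r|)) ^ 2 * D := by
          gcongr <;> linarith [abs_nonneg r]
      _ = (1 + (x + |r|)) ^ (m + j + 2) * D := by ring
  rw [ρ.truncatedKernel_eq_neg hone hε hT0, abs_neg, ← Real.norm_eq_abs]
  calc _ ≤ (1 + x) ^ m * ∫ r in Set.Iic (0:ℝ), ‖r ^ j / (Nat.factorial j : ℝ) *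
        (dilation ρ T (x - r) - dilation ρ ε (x - r))‖ := by
        gcongr; exact norm_integral_le_integral_norm _
    _ = ∫ r in Set.Iic (0:ℝ), (1 + x) ^ m * ‖r ^ j / (Nat.factorial j : ℝ) *
        (dilation ρ T (x - r) - dilation ρ ε (x - r))‖ := (integral_const_mul _ _).symm
    _ ≤ ∫ r in Set.Iic (0:ℝ), C * (1 + ε) * T * ((1 + |r|) ^ 2)⁻¹ := by
        refine integral_mono_of_nonneg (.of_forall fun r => by positivity)
          (integrable_inv_one_add_abs_sq.const_mul _).integrableOn
          (ae_restrict_of_forall_mem measurableSet_Iic hpt)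
    _ ≤ ∫ r : ℝ, C * (1 + ε) * T * ((1 + |r|) ^ 2)⁻¹ :=
        setIntegral_le_integral (integrable_inv_one_add_abs_sq.const_mul _)
          (.of_forall fun r => by positivity)
    _ = _ := by rw [integral_const_mul]; ring

lemma measurable_truncatedKernel (ρ : SchwartzMap ℝ ℝ) (ε : ℝ) (j : ℕ) (T : ℝ) :
    Measurable (truncatedKernel ρ ε j T) := by
  have hρ := ρ.continuous
  refine (StronglyMeasurable.integral_prod_right (ν := volume.restrict (Set.Ioi 0))
    (f := fun x r : ℝ => r ^ j / (Nat.factorial j : ℝ) *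
      (T * ρ (T * (x - r)) - ε * ρ (ε * (x - r)))) ?_).measurable
  refine Continuous.stronglyMeasurable ?_
  unfold Function.uncurry
  fun_prop

end SchwartzMap

lemma exists_natPow_bound {N : ℝ → ℝ}
    (hpoly : ∃ C p : ℝ, ∀ l : ℝ, |N l| ≤ C * (1 + |l|) ^ p) :
    ∃ B, 0 ≤ B ∧ ∃ q : ℕ, ∀ l : ℝ, |N l| ≤ B * (1 + |l|) ^ q := by
  obtain ⟨C, p, h⟩ := hpoly
  refine ⟨|C|, abs_nonneg C, ⌈p⌉₊, fun l => (h l).trans ?_⟩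
  have h1 : (1:ℝ) ≤ 1 + |l| := by linarith [abs_nonneg l]
  rw [← Real.rpow_natCast]
  exact mul_le_mul (le_abs_self C) (Real.rpow_le_rpow_of_exponent_le h1 (Nat.le_ceil p))
    (by positivity) (abs_nonneg C)

/-- If `f` is not integrable then neither is `f - g`, and both of their integrals vanish. -/
lemma abs_integral_sub_integral_sub_le {f g : ℝ → ℝ} (hg : Integrable g) :
    |(∫ t, f t) - ∫ t, (f t - g t)| ≤ |∫ t, g t| := by
  by_cases hf : Integrable f
  · rw [integral_sub hf hg, sub_sub_cancel]
  · have hfg : ¬ Integrable fun t => f t - g t := fun h =>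
      hf ((h.add hg).congr (.of_forall fun t => sub_add_cancel (f t) (g t)))
    rw [integral_undef hf, integral_undef hfg, sub_zero, abs_zero]
    exact abs_nonneg _

/-- Replacing `N` by `N^{odd}` in the convolution with `χ₊^{k-1} ∗ (ρ_T − ρ_ε)`
produces an error of order `O(e^{cT} λ^{-∞})` as `λ → +∞`, uniformly in `T ≥ 1`. -/
theorem stmt_13 (ρ : SchwartzMap ℝ ℝ) (heven : ∀ t, ρ (-t) = ρ t)
    (hsupp : ∀ ξ : ℝ, 1 < |ξ| → FT (fun t => (ρ t : ℂ)) ξ = 0)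
    (hone : ∃ δ > (0:ℝ), ∀ ξ : ℝ, |ξ| < δ → FT (fun t => (ρ t : ℂ)) ξ = 1)
    (ε : ℝ) (hε : 0 < ε) (k : ℕ) (hk : 1 ≤ k)
    (N : ℝ → ℝ) (hmono : Monotone N) (hNsupp : ∀ l : ℝ, l < 0 → N l = 0)
    (hpoly : ∃ C p : ℝ, ∀ l : ℝ, |N l| ≤ C * (1 + |l|) ^ p) :
    ∀ c : ℝ, 0 < c → ∀ n : ℕ, ∃ C : ℝ, ∀ T : ℝ, 1 ≤ T → ∀ l : ℝ, 1 ≤ l →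
      |(∫ τ : ℝ, N τ *
          ∫ r in Set.Ioi (0:ℝ), r ^ (k - 1) / (Nat.factorial (k - 1) : ℝ) *
            (T * ρ (T * (l - τ - r)) - ε * ρ (ε * (l - τ - r))))
        - ∫ τ : ℝ, (N τ - N (-τ)) *
          ∫ r in Set.Ioi (0:ℝ), r ^ (k - 1) / (Nat.factorial (k - 1) : ℝ) *
            (T * ρ (T * (l - τ - r)) - ε * ρ (ε * (l - τ - r)))|
        ≤ C * Real.exp (c * T) * l ^ (-(n : ℤ)) := by
  intro c hc n
  obtain ⟨B, hB0, q, hB⟩ := exists_natPow_bound hpoly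
  obtain ⟨A, hA0, hA⟩ := ρ.exists_truncatedKernel_decay hone hε (k - 1) (n + (q + 2))
  set J := ∫ τ : ℝ, ((1 + |τ|) ^ 2)⁻¹
  have hJ0 : 0 ≤ J := integral_nonneg fun τ => by positivity
  refine ⟨B * A * J * c⁻¹, fun T hT l hl => ?_⟩
  have hT0 : 0 < T := one_pos.trans_le hT
  have hl0 : 0 < l := one_pos.trans_le hl
  have hbound : ∀ τ : ℝ, ‖N (-τ) * truncatedKernel ρ ε (k - 1) T (l - τ)‖
      ≤ B * A * T * (l ^ n)⁻¹ * ((1 + |τ|) ^ 2)⁻¹ := by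
    intro τ
    rcases lt_or_ge 0 τ with hτ | hτ
    · rw [hNsupp (-τ) (by linarith), zero_mul, norm_zero]
      positivity
    have hK := hA T hT (l - τ) (by linarith)
    have hlow : l ^ n * (1 + |τ|) ^ (q + 2) ≤ (1 + (l - τ)) ^ (n + (q + 2)) := by
      have h1 : 0 ≤ 1 + -τ := by linarith
      have h2 : 0 ≤ 1 + (l - τ) := by linarith
      rw [pow_add _ n, abs_of_nonpos hτ]
      gcongr ?_ ^ n * ?_ ^ (q + 2) <;> first | positivity | linarith
    have hN := hB (-τ)
    rw [abs_neg] at hN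
    rw [norm_mul, Real.norm_eq_abs, Real.norm_eq_abs]
    set K := |truncatedKernel ρ ε (k - 1) T (l - τ)|
    have hK' : l ^ n * (1 + |τ|) ^ (q + 2) * K ≤ A * T := le_trans (by gcongr) hK
    calc |N (-τ)| * K ≤ B * (1 + |τ|) ^ q * K := by gcongr
      _ = B * (l ^ n * (1 + |τ|) ^ (q + 2) * K) * ((l ^ n)⁻¹ * ((1 + |τ|) ^ 2)⁻¹) := by
          field_simp; ring
      _ ≤ B * (A * T) * ((l ^ n)⁻¹ * ((1 + |τ|) ^ 2)⁻¹) := by gcongr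
      _ = _ := by ring
  have hdom := integrable_inv_one_add_abs_sq.const_mul (B * A * T * (l ^ n)⁻¹)
  have hint : Integrable fun τ => N (-τ) * truncatedKernel ρ ε (k - 1) T (l - τ) :=
    hdom.mono' (((hmono.measurable.comp measurable_neg).mul
      ((ρ.measurable_truncatedKernel ε (k - 1) T).comp
        (measurable_const.sub measurable_id))).aestronglyMeasurable) (.of_forall hbound)
  have hexp : T ≤ c⁻¹ * Real.exp (c * T) := by
    rw [inv_mul_eq_div, le_div_iff₀ hc]
    linarith [Real.add_one_le_exp (c * T)]
  simp only [sub_mul]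
  calc _ ≤ |∫ τ, N (-τ) * truncatedKernel ρ ε (k - 1) T (l - τ)| :=
        abs_integral_sub_integral_sub_le hint
    _ ≤ ∫ τ : ℝ, B * A * T * (l ^ n)⁻¹ * ((1 + |τ|) ^ 2)⁻¹ :=
        norm_integral_le_of_norm_le hdom (.of_forall hbound)
    _ = B * A * J * (l ^ n)⁻¹ * T := by rw [integral_const_mul]; ring
    _ ≤ B * A * J * (l ^ n)⁻¹ * (c⁻¹ * Real.exp (c * T)) := by gcongr
    _ = _ := by rw [zpow_neg, zpow_natCast]; ring
end

section
/- Let ρ be an even real Schwartz function with ρ̂ supported in [-1,1] and ρ̂ = 1 on (-1/2,1/2), let ρ_T(t) = Tρ(Tt), and let N: ℝ → ℝ be nondecreasing, supported in [0,∞). Fix constants c₁, c > 0, d ≥ 1, and suppose there exist ρ̃_T (nonnegative even Schwartz, ρ̃̂_T supported in [-T/2, T/2]) with ρ_T ∗ ρ̃_T = ρ̃_T and such that |N ∗ (δ − ρ̃_T)(λ)| ≤ (c/T)(1+|λ|)^{d-1} + e^{cT}(1+|λ|)^{(d-1)/2} for all T ≥ 1. Then there exists c' > 0 such that |N ∗ (δ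 − ρ_T)(λ)| ≤ (c'/T)(1+|λ|)^{d-1} + e^{c'T}(1+|λ|)^{(d-1)/2} for all T ≥ 1 and λ ∈ ℝ. -/
open MeasureTheory

theorem weight_add_le (R : ℝ) (hR : 0 < R) (k : ℕ) (x t : ℝ) :
    (1 + |x + t| / R) ^ k ≤ (1 + |x| / R) ^ k * (1 + |t| / R) ^ k := by
  rw [← mul_pow]
  have h : |x + t| / R ≤ |x| / R + |t| / R := by
    rw [← add_div]; gcongr; exact abs_add_le x t
  have h2 : 0 ≤ |x| / R * (|t| / R) := by positivity
  gcongr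
  nlinarith

theorem SchwartzMap.integrable_weight_mul (f : SchwartzMap ℝ ℝ) (k : ℕ) :
    Integrable fun t => (1 + |t|) ^ k * |f t| := by
  have h1 := (f.integrable_pow_mul volume k)
  have h0 := (f.integrable_pow_mul volume 0)
  refine ((h0.add h1).const_mul (2 ^ (k - 1))).mono' ?_ (Filter.Eventually.of_forall fun t => ?_)
  · exact Continuous.aestronglyMeasurable (by fun_prop)
  · rw [Real.norm_of_nonneg (by positivity)]
    have := add_pow_le (zero_le_one' ℝ) (abs_nonneg t) k
    simp only [Pi.add_apply, pow_zero, one_mul, Real.norm_eq_abs, one_pow] at *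
    calc _ ≤ (2 ^ (k - 1) * (1 + |t| ^ k)) * |f t| := by gcongr
      _ = _ := by ring

theorem integral_translate_of_even (u g : ℝ → ℝ) (heven : ∀ t, g (-t) = g t) (l : ℝ) :
    ∫ τ, u τ * g (l - τ) = ∫ t, u (l + t) * g t := by
  rw [← integral_add_left_eq_self _ l]
  congr 1 with t
  rw [sub_add_cancel_left, heven]

theorem truncated_square_second_difference {R x : ℝ} (hx : 0 < x) (hxR : x < R) (t : ℝ) :
    t ^ 2 - 3 / R ^ 2 * t ^ 4 ≤ min ((max (x + t) 0) ^ 2) (4 * R ^ 2)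
      + min ((max (x - t) 0) ^ 2) (4 * R ^ 2) - 2 * min ((max x 0) ^ 2) (4 * R ^ 2) := by
  have hR : 0 < R := hx.trans hxR
  wlog ht : 0 ≤ t generalizing t
  · have := this (-t) (by linarith)
    simp only [even_two.neg_pow, (by decide : Even 4).neg_pow, sub_neg_eq_add, ← sub_eq_add_neg]
      at this
    linarith
  have e1 : min ((max x 0) ^ 2) (4 * R ^ 2) = x ^ 2 := by
    rw [max_eq_left hx.le, min_eq_left]; nlinarith
  rw [e1]
  have h3 : 0 ≤ 3 / R ^ 2 * t ^ 4 := by positivity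
  rcases le_or_gt t R with h | h
  · have e2 : min ((max (x + t) 0) ^ 2) (4 * R ^ 2) = (x + t) ^ 2 := by
      rw [max_eq_left (by linarith), min_eq_left]; nlinarith
    have e3 : min ((max (x - t) 0) ^ 2) (4 * R ^ 2) = (max (x - t) 0) ^ 2 := by
      apply min_eq_left
      have : max (x - t) 0 ≤ R := max_le (by linarith) hR.le
      nlinarith [le_max_right (x - t) 0]
    rw [e2, e3]
    rcases le_total t x with h' | h'
    · rw [max_eq_left (by linarith)]; nlinarith
    · rw [max_eq_right (by linarith)]; nlinarith
  · have a1 : 0 ≤ min ((max (x + t) 0) ^ 2) (4 * R ^ 2) := by positivity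
    have a2 : 0 ≤ min ((max (x - t) 0) ^ 2) (4 * R ^ 2) := by positivity
    have a3 : 3 * t ^ 2 ≤ 3 / R ^ 2 * t ^ 4 := by
      rw [div_mul_eq_mul_div, le_div_iff₀ (by positivity)]
      have : R ^ 2 ≤ t ^ 2 := by nlinarith
      nlinarith [sq_nonneg t]
    nlinarith

theorem integral_truncated_square_ge {g : ℝ → ℝ} (hg : ∀ t, 0 ≤ g t)
    (heven : ∀ t, g (-t) = g t) (hint : ∀ k : ℕ, Integrable fun t => |t| ^ k * g t)
    (hmass : ∫ t, g t = 1) {R x : ℝ} (hx : 0 < x) (hxR : x < R) :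
    (Integrable fun t => min ((max (x + t) 0) ^ 2) (4 * R ^ 2) * g t) ∧
    min ((max x 0) ^ 2) (4 * R ^ 2)
      + ((∫ t, t ^ 2 * g t) - 3 / R ^ 2 * ∫ t, t ^ 4 * g t) / 2
      ≤ ∫ t, min ((max (x + t) 0) ^ 2) (4 * R ^ 2) * g t := by
  set q : ℝ → ℝ := fun y => min ((max y 0) ^ 2) (4 * R ^ 2) with hq
  have hqc : Continuous q := by fun_prop
  have hgi : Integrable g := by simpa using hint 0
  have h2 : Integrable fun t => t ^ 2 * g t := by simpa using hint 2
  have h4 : Integrable fun t => t ^ 4 * g t := by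
    simpa [(by decide : Even 4).pow_abs] using hint 4
  have hqb : ∀ y, ‖q y‖ ≤ 4 * R ^ 2 := fun y => by
    rw [Real.norm_of_nonneg (by positivity)]; exact min_le_right _ _
  have hp : Integrable fun t => q (x + t) * g t :=
    hgi.bdd_mul (c := 4 * R ^ 2) (hqc.comp (by fun_prop)).aestronglyMeasurable
      (Filter.Eventually.of_forall fun t => hqb _)
  have hm : Integrable fun t => q (x - t) * g t :=
    hgi.bdd_mul (c := 4 * R ^ 2) (hqc.comp (by fun_prop)).aestronglyMeasurable
      (Filter.Eventually.of_forall fun t => hqb _)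
  refine ⟨hp, ?_⟩
  have hsymm : ∫ t, q (x - t) * g t = ∫ t, q (x + t) * g t := by
    rw [← integral_neg_eq_self]
    simp [heven]
  have key : ∫ t, (t ^ 2 * g t - 3 / R ^ 2 * (t ^ 4 * g t))
      ≤ ∫ t, (q (x + t) * g t + q (x - t) * g t - 2 * q x * g t) := by
    refine integral_mono (h2.sub (h4.const_mul _)) ((hp.add hm).sub (hgi.const_mul (2 * q x)))
      fun t => ?_
    have := mul_le_mul_of_nonneg_right (truncated_square_second_difference hx hxR t) (hg t)
    simp only [hq]
    linarith
  have hpm : Integrable fun t => q (x + t) * g t + q (x - t) * g t := hp.add hm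
  rw [integral_sub h2 (h4.const_mul _), integral_sub hpm (hgi.const_mul _),
    integral_add hp hm, integral_const_mul, integral_const_mul, hmass, hsymm] at key
  change q x + _ ≤ ∫ t, q (x + t) * g t
  linarith

/-- A nonnegative monotone function that is superharmonic up to a polynomial error, with respect to
an even probability density with all moments, has polynomial growth. -/
theorem polynomial_growth_of_mass_one {g : ℝ → ℝ} (hg : ∀ t, 0 ≤ g t)
    (heven : ∀ t, g (-t) = g t) (hint : ∀ k : ℕ, Integrable fun t => |t| ^ k * g t)
    (hmass : ∫ t, g t = 1) {u : ℝ → ℝ} (hu : Monotone u) (hu0 : ∀ x, 0 ≤ u x)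
    (hui : ∀ x, Integrable fun t => u (x + t) * g t) {D : ℝ} (hD : 0 ≤ D) (k : ℕ)
    (hsuper : ∀ x, ∫ t, u (x + t) * g t ≤ u x + D * (1 + |x|) ^ k) :
    ∃ C : ℝ, ∃ K : ℕ, ∀ x, u x ≤ C * (1 + |x|) ^ K := by
  set μ := ∫ t, t ^ 2 * g t with hμ
  set ν := ∫ t, t ^ 4 * g t with hν
  have hμ0 : 0 < μ := by
    refine (integral_nonneg fun t => mul_nonneg (sq_nonneg t) (hg t)).lt_of_ne' fun h => ?_
    rw [integral_eq_zero_iff_of_nonneg (fun t => mul_nonneg (sq_nonneg t) (hg t))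
      (by simpa using hint 2)] at h
    have : ∫ t, g t = 0 := by
      refine integral_eq_zero_of_ae ?_
      filter_upwards [h, Measure.ae_ne volume (0 : ℝ)] with t ht h0
      simpa [h0] using ht
    linarith
  have hν0 : 0 ≤ ν := integral_nonneg fun t => mul_nonneg (by positivity) (hg t)
  obtain ⟨R₀, hR₀⟩ : ∃ R₀ : ℝ, 1 ≤ R₀ ∧ 6 * ν / μ ≤ R₀ :=
    ⟨max 1 (6 * ν / μ), le_max_left _ _, le_max_right _ _⟩
  have main : ∀ R, R₀ ≤ R → u R ≤ 4 * R ^ 2 * u 1 + 16 * R ^ 2 * (D * (1 + R) ^ k) / μ := by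
    intro R hR
    have hR1 : 1 ≤ R := hR₀.1.trans hR
    have hRν : 3 / R ^ 2 * ν ≤ μ / 2 := by
      have h := hR₀.2.trans hR
      rw [div_le_iff₀ hμ0] at h
      rw [div_mul_eq_mul_div, div_le_iff₀ (by positivity)]
      nlinarith [mul_nonneg (sub_nonneg.2 hR1) hμ0.le, mul_nonneg (by linarith : 0 ≤ R) hμ0.le]
    set lam := u R / (4 * R ^ 2) with hlam
    have hlamR : lam * (4 * R ^ 2) = u R := by rw [hlam]; field_simp
    have hlam0 : 0 ≤ lam := div_nonneg (hu0 R) (by positivity)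
    rcases le_or_gt (lam * (μ / 4)) (D * (1 + R) ^ k) with h | h
    · have h1 : u R ≤ 16 * R ^ 2 * (D * (1 + R) ^ k) / μ := by
        rw [le_div_iff₀ hμ0, ← hlamR]
        nlinarith [mul_le_mul_of_nonneg_left h (by positivity : 0 ≤ 16 * R ^ 2)]
      have : 0 ≤ 4 * R ^ 2 * u 1 := mul_nonneg (by positivity) (hu0 1)
      linarith
    · set q : ℝ → ℝ := fun y => min ((max y 0) ^ 2) (4 * R ^ 2) with hq
      have hcmp : ∀ x, 0 ≤ u x - lam * q x := by
        by_contra! hneg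
        obtain ⟨x₁, hx₁⟩ := hneg
        have hb : BddBelow (Set.range fun x => u x - lam * q x) := by
          refine ⟨-(lam * (4 * R ^ 2)), ?_⟩
          rintro _ ⟨x, rfl⟩
          have : lam * q x ≤ lam * (4 * R ^ 2) :=
            mul_le_mul_of_nonneg_left (min_le_right _ _) hlam0
          simp only
          linarith [hu0 x]
        set m := ⨅ x, (u x - lam * q x) with hm
        have hm0 : m < 0 := (ciInf_le hb x₁).trans_lt hx₁
        obtain ⟨x, hx⟩ := exists_lt_of_ciInf_lt
          (show m < min 0 (m + (lam * (μ / 4) - D * (1 + R) ^ k)) from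
            lt_min hm0 (by linarith))
        have hxa := hx.trans_le (min_le_left _ _)
        have hxb := hx.trans_le (min_le_right _ _)
        have hx0 : 0 < x := by
          by_contra! hx0
          have : q x = 0 := by simp [hq, max_eq_right hx0]; positivity
          rw [this] at hxa
          linarith [hu0 x]
        have hxR : x < R := by
          by_contra! hxR
          have : lam * q x ≤ lam * (4 * R ^ 2) :=
            mul_le_mul_of_nonneg_left (min_le_right _ _) hlam0
          linarith [hu hxR]
        obtain ⟨hqi, hqge⟩ := integral_truncated_square_ge hg heven hint hmass hx0 hxR
        have hgi : Integrable g := by simpa using hint 0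
        have h1 : m ≤ ∫ t, (u (x + t) * g t - lam * (q (x + t) * g t)) := by
          calc m = ∫ t, m * g t := by rw [integral_const_mul, hmass, mul_one]
            _ ≤ _ := by
              refine integral_mono (hgi.const_mul m) ((hui x).sub (hqi.const_mul _)) fun t => ?_
              have := mul_le_mul_of_nonneg_right (ciInf_le hb (x + t)) (hg t)
              simp only
              linarith
        rw [integral_sub (hui x) (hqi.const_mul _), integral_const_mul] at h1
        have h2 : lam * (q x + μ / 4) ≤ lam * ∫ t, q (x + t) * g t := by
          refine mul_le_mul_of_nonneg_left (le_trans ?_ hqge) hlam0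
          change q x + _ ≤ q x + _
          linarith
        have h3 : D * (1 + |x|) ^ k ≤ D * (1 + R) ^ k := by
          rw [abs_of_pos hx0]; gcongr
        have := hsuper x
        linarith
      have h1 := hcmp 1
      have hq1 : q 1 = 1 := by
        simp only [hq]
        rw [max_eq_left (by norm_num), min_eq_left] <;> nlinarith
      rw [hq1] at h1
      have h4 : lam * (4 * R ^ 2) ≤ u 1 * (4 * R ^ 2) := by gcongr; linarith
      have : 0 ≤ 16 * R ^ 2 * (D * (1 + R) ^ k) / μ := by positivity
      linarith
  refine ⟨4 * u 1 + 16 * D / μ + u R₀, k + 2, fun x => ?_⟩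
  have hone : (1 : ℝ) ≤ (1 + |x|) ^ (k + 2) := one_le_pow₀ (by linarith [abs_nonneg x])
  rcases le_total x R₀ with h | h
  · have h0 : 0 ≤ 4 * u 1 + 16 * D / μ := by have := hu0 1; positivity
    have := hu h
    have := hu0 R₀
    nlinarith
  · have hx0 : 0 ≤ x := by linarith [hR₀.1]
    have hm := main x h
    rw [abs_of_nonneg hx0] at *
    have e1 : x ^ 2 ≤ (1 + x) ^ (k + 2) := by
      calc x ^ 2 ≤ (1 + x) ^ 2 := by gcongr; linarith
        _ ≤ _ := pow_le_pow_right₀ (by linarith) (by omega)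
    have e2 : x ^ 2 * (1 + x) ^ k ≤ (1 + x) ^ (k + 2) := by
      rw [pow_add, mul_comm]; gcongr; linarith
    calc u x ≤ 4 * u 1 * x ^ 2 + 16 * D / μ * (x ^ 2 * (1 + x) ^ k) := by
          refine hm.trans (le_of_eq ?_); ring
      _ ≤ 4 * u 1 * (1 + x) ^ (k + 2) + 16 * D / μ * (1 + x) ^ (k + 2) := by
          have := hu0 1; gcongr
      _ ≤ _ := by
          have := mul_nonneg (hu0 R₀) (by linarith : 0 ≤ (1 + x) ^ (k + 2))
          linarith

/-- A nonzero integrable even nonnegative density with compactly supported Fourier transform has no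
exponential moments. -/
theorem integral_eq_zero_of_exp_moment {g : ℝ → ℝ} (hg : ∀ t, 0 ≤ g t)
    (heven : ∀ t, g (-t) = g t) (hgc : Continuous g) (hgi : Integrable g) {B : ℝ}
    (hFT : ∀ ξ : ℝ, B < |ξ| → FT (fun t => (g t : ℂ)) ξ = 0) {a b : ℝ} (ha : 0 < a)
    (hexp : IntegrableOn (fun t => Real.exp (a * t) * g t) (Set.Ioi b)) :
    ∫ t, g t = 0 := by
  set ν : Measure ℝ := volume.withDensity fun t => ENNReal.ofReal (g t) with hν
  have hmeas : Measurable fun t => (g t).toNNReal := hgc.measurable.real_toNNReal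
  have hint : ∀ f : ℝ → ℂ, ∫ t, f t ∂ν = ∫ t, (g t : ℂ) * f t := by
    intro f
    rw [hν, integral_withDensity_eq_integral_toReal_smul₀ (by fun_prop) (by simp)]
    simp [ENNReal.toReal_ofReal (hg _)]
  have hpos : Integrable fun t => Real.exp (a * t) * g t := by
    rw [← integrableOn_univ, ← Set.Iic_union_Ioi (a := b)]
    refine IntegrableOn.union ?_ hexp
    refine (hgi.const_mul (Real.exp (a * b))).integrableOn.mono'
      (by fun_prop) ?_
    filter_upwards [ae_restrict_mem measurableSet_Iic] with t ht
    rw [Real.norm_of_nonneg (mul_nonneg (Real.exp_pos _).le (hg t))]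
    exact mul_le_mul_of_nonneg_right (Real.exp_le_exp.2 (by gcongr; exact ht)) (hg t)
  have hset : Set.Icc (-a) a ⊆ ProbabilityTheory.integrableExpSet id ν := by
    intro s hs
    change Integrable (fun t => Real.exp (s * id t)) ν
    rw [hν, integrable_withDensity_iff_integrable_smul₀' (by fun_prop) (by simp)]
    simp only [ENNReal.toReal_ofReal (hg _), smul_eq_mul, id]
    have hneg : Integrable fun t => Real.exp (-(a * t)) * g t := by
      simpa [heven] using hpos.comp_neg
    refine (hpos.add hneg).mono' (by fun_prop) (Filter.Eventually.of_forall fun t => ?_)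
    rw [Real.norm_of_nonneg (mul_nonneg (hg t) (Real.exp_pos _).le), Pi.add_apply, ← add_mul,
      mul_comm]
    refine mul_le_mul_of_nonneg_right ?_ (hg t)
    rcases le_total 0 t with h | h
    · have : Real.exp (s * t) ≤ Real.exp (a * t) := Real.exp_le_exp.2 (by nlinarith [hs.2])
      linarith [Real.exp_pos (-(a * t))]
    · have : Real.exp (s * t) ≤ Real.exp (-(a * t)) := Real.exp_le_exp.2 (by nlinarith [hs.1])
      linarith [Real.exp_pos (a * t)]
  set S : Set ℂ := {z | z.re ∈ Set.Ioo (-a) a} with hS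
  have hanal : AnalyticOnNhd ℂ (ProbabilityTheory.complexMGF id ν) S := fun z hz =>
    ProbabilityTheory.analyticAt_complexMGF
      (interior_mono hset (by rw [interior_Icc]; exact hz))
  have hconn : IsPreconnected S :=
    ((convex_Ioo (-a) a).linear_preimage Complex.reLm).isPreconnected
  have hzero : ∀ ξ : ℝ, B < |ξ| →
      ProbabilityTheory.complexMGF id ν (-(Complex.I * ξ)) = 0 := by
    intro ξ hξ
    rw [ProbabilityTheory.complexMGF, hint, ← hFT ξ hξ, FT]
    congr 1 with t
    simp only [id]
    congr 2
    ring
  have hmem : ∀ ξ : ℝ, -(Complex.I * ξ) ∈ S := fun ξ => by simp [hS, ha]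
  have hfreq : ∃ᶠ z in nhdsWithin (-(Complex.I * ((|B| + 1 : ℝ) : ℂ)))
      {-(Complex.I * ((|B| + 1 : ℝ) : ℂ))}ᶜ,
      ProbabilityTheory.complexMGF id ν z = 0 := by
    have ht : Filter.Tendsto (fun ξ : ℝ => -(Complex.I * (ξ : ℂ))) (nhdsWithin (|B| + 1) {|B| + 1}ᶜ)
        (nhdsWithin (-(Complex.I * ((|B| + 1 : ℝ) : ℂ))) {-(Complex.I * ((|B| + 1 : ℝ) : ℂ))}ᶜ) := by
      refine Filter.Tendsto.inf (Continuous.tendsto (by fun_prop) _) ?_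
      rw [Filter.tendsto_principal_principal]
      intro ξ hξ h
      apply hξ
      exact_mod_cast mul_left_cancel₀ Complex.I_ne_zero (neg_injective h)
    refine ht.frequently (Filter.Eventually.frequently ?_)
    filter_upwards [nhdsWithin_le_nhds (lt_mem_nhds (lt_add_one |B|))] with ξ hξ
    exact hzero ξ ((le_abs_self B).trans_lt (hξ.trans_le (le_abs_self ξ)))
  have h0 := hanal.eqOn_zero_of_preconnected_of_frequently_eq_zero hconn (hmem _) hfreq (hmem 0)
  rw [ProbabilityTheory.complexMGF, hint] at h0
  simp only [Complex.ofReal_zero, mul_zero, neg_zero, zero_mul, Complex.exp_zero, mul_one,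
    Pi.zero_apply] at h0
  rw [integral_complex_ofReal] at h0
  exact_mod_cast h0

theorem exists_scale_integral_weight_lt_one {g : ℝ → ℝ} (hg : ∀ t, 0 ≤ g t)
    (k : ℕ) (hint : Integrable fun t => (1 + |t|) ^ k * g t) (hgi : Integrable g)
    (hmass : ∫ t, g t < 1) : ∃ R : ℝ, 1 ≤ R ∧ ∫ t, (1 + |t| / R) ^ k * g t < 1 := by
  have h : Filter.Tendsto (fun R : ℝ => ∫ t, (1 + |t| / R) ^ k * g t) Filter.atTop
      (nhds (∫ t, g t)) := by
    refine tendsto_integral_filter_of_dominated_convergence (fun t => (1 + |t|) ^ k * g t) ?_ ?_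
      hint ?_
    · exact Filter.Eventually.of_forall fun R =>
        (Continuous.aestronglyMeasurable (by fun_prop)).mul hgi.aestronglyMeasurable
    · filter_upwards [Filter.eventually_ge_atTop 1] with R hR
      refine Filter.Eventually.of_forall fun t => ?_
      rw [Real.norm_of_nonneg (mul_nonneg (by positivity) (hg t))]
      have := div_le_self (abs_nonneg t) hR
      have := hg t
      gcongr
    · refine Filter.Eventually.of_forall fun t => ?_
      have : Filter.Tendsto (fun R : ℝ => |t| / R) Filter.atTop (nhds 0) :=
        Filter.Tendsto.div_atTop tendsto_const_nhds Filter.tendsto_id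
      simpa using ((this.const_add 1).pow k).mul_const (g t)
  obtain ⟨R, h1, h2⟩ := ((Filter.eventually_ge_atTop (1 : ℝ)).and (h.eventually_lt_const
    hmass)).exists
  exact ⟨R, h1, h2⟩

theorem polynomial_growth_of_increment {u : ℝ → ℝ} (hu : Monotone u) (hu0 : ∀ x, 0 ≤ u x)
    {a C : ℝ} (ha : 0 < a) (hC : 0 ≤ C) (k : ℕ)
    (hinc : ∀ x, 0 ≤ x → u (x + a) ≤ u x + C * (1 + |x + a|) ^ k) :
    ∃ C : ℝ, ∃ K : ℕ, ∀ x, u x ≤ C * (1 + |x|) ^ K := by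
  have hind : ∀ n : ℕ, u (n * a) ≤ u 0 + n * (C * (1 + n * a) ^ k) := by
    intro n
    induction n with
    | zero => simp
    | succ n ih =>
      have h := hinc (n * a) (by positivity)
      rw [abs_of_nonneg (by positivity)] at h
      have e : ((n + 1 : ℕ) : ℝ) * a = n * a + a := by push_cast; ring
      rw [e]
      have : (n : ℝ) * (C * (1 + n * a) ^ k) ≤ n * (C * (1 + (n * a + a)) ^ k) := by
        gcongr; linarith
      push_cast
      linarith
  refine ⟨u 0 + (1 / a + 1) * (C * (1 + a) ^ k), k + 1, fun x => ?_⟩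
  have hone : (1 : ℝ) ≤ (1 + |x|) ^ (k + 1) := one_le_pow₀ (by linarith [abs_nonneg x])
  have hpos : 0 ≤ (1 / a + 1) * (C * (1 + a) ^ k) := by positivity
  have hub : u 0 ≤ u 0 * (1 + |x|) ^ (k + 1) := le_mul_of_one_le_right (hu0 0) hone
  set n := ⌈|x| / a⌉₊ with hn
  have h1 : |x| ≤ n * a := by
    have := Nat.le_ceil (|x| / a)
    rwa [div_le_iff₀ ha] at this
  have h2 : (n : ℝ) ≤ |x| / a + 1 := (Nat.ceil_lt_add_one (by positivity)).le
  have h3 : n * a ≤ |x| + a := by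
    calc n * a ≤ (|x| / a + 1) * a := by gcongr
      _ = _ := by field_simp
  calc u x ≤ u (n * a) := hu ((le_abs_self x).trans h1)
    _ ≤ u 0 + n * (C * (1 + n * a) ^ k) := hind n
    _ ≤ u 0 + ((1 / a + 1) * (1 + |x|)) * (C * ((1 + a) * (1 + |x|)) ^ k) := by
        have e1 : (n : ℝ) ≤ (1 / a + 1) * (1 + |x|) := by
          have : 0 ≤ 1 / a := by positivity
          have : |x| / a = 1 / a * |x| := by ring
          nlinarith [abs_nonneg x]
        have e2 : 1 + n * a ≤ (1 + a) * (1 + |x|) := by nlinarith [abs_nonneg x]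
        gcongr
    _ = u 0 + (1 / a + 1) * (C * (1 + a) ^ k) * (1 + |x|) ^ (k + 1) := by
        rw [mul_pow]; ring
    _ ≤ _ := by linarith

/-- If `U ≥ u` is superharmonic for `g`, and `r U - V (· + a) ≥ 0` is superharmonic and nearly
vanishes somewhere relative to `U`, where `V ≤ u` and `r > ρ > 1`, then `u` grows geometrically
from that point on. -/
theorem exists_geometric_growth {g : ℝ → ℝ} (hg : ∀ t, 0 ≤ g t) (hgi : Integrable g)
    {u U V : ℝ → ℝ} (hu : Monotone u) (huU : ∀ x, u x ≤ U x) (hVu : ∀ x, V x ≤ u x)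
    (hU : ∀ x, 0 < U x) {a b r ρ : ℝ} (hab : a ≤ b) (hA : 0 < ∫ t in a..b, g t)
    (hA1 : ∫ t in a..b, g t ≤ 1)
    (hρ : 1 < ρ) (hr : ρ < r) (hk : ∀ x, V (x + a) ≤ r * U x)
    (hki : ∀ x, Integrable fun t => (r * U (x + t) - V (x + t + a)) * g t)
    (hks : ∀ x, ∫ t, (r * U (x + t) - V (x + t + a)) * g t ≤ r * U x - V (x + a))
    (hsharp : ∀ ε > 0, ∃ x, (r - ε) * U x < V (x + a)) (J : ℕ) :
    ∃ x, ∀ i : ℕ, i ≤ J → ρ ^ (i + 1) * U x ≤ u (x + (i + 1) * b) := by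
  set A := ∫ t in a..b, g t with hAdef
  have hnext : ∀ y η : ℝ, 0 < η → r * U y - V (y + a) ≤ η →
      ∃ t ∈ Set.Ioc a b, r * U (y + t) - V (y + t + a) ≤ 2 / A * η := by
    intro y η hη hy
    by_contra! hcon
    have h1 : 2 / A * η * A ≤ ∫ t in Set.Ioc a b, (r * U (y + t) - V (y + t + a)) * g t := by
      have e : 2 / A * η * A = ∫ t in Set.Ioc a b, 2 / A * η * g t := by
        rw [integral_const_mul, ← intervalIntegral.integral_of_le hab]
      rw [e]
      refine setIntegral_mono_on (hgi.const_mul _).integrableOn (hki y).integrableOn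
        measurableSet_Ioc fun t ht => ?_
      exact mul_le_mul_of_nonneg_right (hcon t ht).le (hg t)
    have h2 : ∫ t in Set.Ioc a b, (r * U (y + t) - V (y + t + a)) * g t
        ≤ ∫ t, (r * U (y + t) - V (y + t + a)) * g t :=
      setIntegral_le_integral (hki y) (Filter.Eventually.of_forall fun t =>
        mul_nonneg (sub_nonneg.2 (hk _)) (hg t))
    have h3 : 2 / A * η * A = 2 * η := by field_simp
    linarith [hks y]
  obtain ⟨x, hx⟩ := hsharp ((r - ρ) * (A / 2) ^ J)
    (mul_pos (by linarith) (by positivity))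
  have hq : 1 ≤ 2 / A := by rw [le_div_iff₀ hA]; linarith
  have hstep : ∀ y, r * U y - V (y + a) ≤ (r - ρ) * U x → U x ≤ U y → ρ * U y ≤ u (y + a) := by
    intro y h1 h2
    have := mul_le_mul_of_nonneg_left h2 (by linarith : 0 ≤ r - ρ)
    linarith [hVu (y + a)]
  have hbig : ∀ i : ℕ, i ≤ J →
      (2 / A) ^ i * ((r - ρ) * (A / 2) ^ J * U x) ≤ (r - ρ) * U x := by
    intro i hi
    have e : (2 / A) ^ J * (A / 2) ^ J = 1 := by
      rw [← mul_pow, div_mul_div_cancel₀ hA.ne', div_self two_ne_zero, one_pow]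
    calc _ ≤ (2 / A) ^ J * ((r - ρ) * (A / 2) ^ J * U x) := by
          have : 0 ≤ (r - ρ) * (A / 2) ^ J * U x :=
            mul_nonneg (mul_nonneg (by linarith) (by positivity)) (hU x).le
          gcongr
      _ = (2 / A) ^ J * (A / 2) ^ J * ((r - ρ) * U x) := by ring
      _ = _ := by rw [e, one_mul]
  have hchain : ∀ i : ℕ, i ≤ J → ∃ y, y ≤ x + i * b ∧ ρ ^ i * U x ≤ U y ∧
      r * U y - V (y + a) ≤ (2 / A) ^ i * ((r - ρ) * (A / 2) ^ J * U x) := by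
    intro i
    induction i with
    | zero =>
      intro _
      refine ⟨x, by simp, by simp, ?_⟩
      rw [pow_zero, one_mul]
      linarith
    | succ i ih =>
      intro hi
      obtain ⟨y, hy1, hy2, hy3⟩ := ih (by omega)
      have hUxy : U x ≤ U y :=
        (le_mul_of_one_le_left (hU x).le (one_le_pow₀ hρ.le)).trans hy2
      obtain ⟨t, ht, hkt⟩ := hnext y _ (by
        have := hU x
        have : 0 < r - ρ := by linarith
        positivity) hy3
      refine ⟨y + t, ?_, ?_, ?_⟩
      · push_cast; linarith [ht.2]
      · calc ρ ^ (i + 1) * U x = ρ * (ρ ^ i * U x) := by ring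
          _ ≤ ρ * U y := by gcongr
          _ ≤ u (y + a) := hstep y (hy3.trans (hbig i (by omega))) hUxy
          _ ≤ u (y + t) := hu (by linarith [ht.1])
          _ ≤ _ := huU _
      · rw [pow_succ']
        linarith
  refine ⟨x, fun i hi => ?_⟩
  obtain ⟨y, hy1, hy2, hy3⟩ := hchain i hi
  have hUxy : U x ≤ U y := (le_mul_of_one_le_left (hU x).le (one_le_pow₀ hρ.le)).trans hy2
  calc ρ ^ (i + 1) * U x = ρ * (ρ ^ i * U x) := by ring
    _ ≤ ρ * U y := by gcongr
    _ ≤ u (y + a) := hstep y (hy3.trans (hbig i hi)) hUxy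
    _ ≤ _ := hu (by linarith)

/-- A nonnegative monotone function that is harmonic up to a polynomial error, with respect to a
density of mass less than one without exponential moments, has polynomial growth. -/
theorem polynomial_growth_of_mass_lt_one {g : ℝ → ℝ} (hg : ∀ t, 0 ≤ g t) (hgc : Continuous g)
    (hint : ∀ k : ℕ, Integrable fun t => (1 + |t|) ^ k * g t) (hmass : ∫ t, g t < 1)
    (hexp : ∀ a > 0, ∀ b, ¬ IntegrableOn (fun t => Real.exp (a * t) * g t) (Set.Ioi b))
    {u : ℝ → ℝ} (hu : Monotone u) (hu0 : ∀ x, 0 ≤ u x)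
    (hui : ∀ x, Integrable fun t => u (x + t) * g t) {D : ℝ} (hD : 0 < D) (k : ℕ)
    (hsuper : ∀ x, ∫ t, u (x + t) * g t ≤ u x + D * (1 + |x|) ^ k)
    (hsub : ∀ x, u x - D * (1 + |x|) ^ k ≤ ∫ t, u (x + t) * g t) :
    ∃ C : ℝ, ∃ K : ℕ, ∀ x, u x ≤ C * (1 + |x|) ^ K := by
  have hgi : Integrable g := by simpa using hint 0
  obtain ⟨a, ha, hga⟩ : ∃ a, 0 < a ∧ 0 < g a := by
    by_contra! h
    refine hexp 1 one_pos 0 (integrableOn_zero.congr_fun (fun t ht => ?_) measurableSet_Ioi)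
    simp [le_antisymm (h t ht) (hg t)]
  set b := a + 1 with hb
  have hab : a ≤ b := by linarith
  have hA : 0 < ∫ t in a..b, g t :=
    intervalIntegral.integral_pos (by linarith) hgc.continuousOn (fun t _ => hg t)
      ⟨a, Set.left_mem_Icc.2 hab, hga⟩
  have hA1 : ∫ t in a..b, g t ≤ 1 := by
    rw [intervalIntegral.integral_of_le hab]
    exact (setIntegral_le_integral hgi (Filter.Eventually.of_forall hg)).trans hmass.le
  obtain ⟨R, hR, hθ⟩ := exists_scale_integral_weight_lt_one hg k (hint k) hgi hmass
  have hR0 : 0 < R := by linarith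
  set θ := ∫ t, (1 + |t| / R) ^ k * g t with hθdef
  set w : ℝ → ℝ := fun x => (1 + |x| / R) ^ k with hw
  have hw1 : ∀ x, 1 ≤ w x := fun x => one_le_pow₀ (by linarith [div_nonneg (abs_nonneg x) hR0.le])
  have hwi0 : Integrable fun t => w t * g t := by
    refine (hint k).mono' (Continuous.aestronglyMeasurable (by fun_prop))
      (Filter.Eventually.of_forall fun t => ?_)
    rw [Real.norm_of_nonneg (mul_nonneg (by linarith [hw1 t]) (hg t))]
    have := div_le_self (abs_nonneg t) hR
    have := hg t
    simp only [hw]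
    gcongr
  have hwle : ∀ x t, w (x + t) * g t ≤ w x * (w t * g t) := fun x t => by
    rw [← mul_assoc]
    exact mul_le_mul_of_nonneg_right (weight_add_le R hR0 k x t) (hg t)
  have hwi : ∀ x, Integrable fun t => w (x + t) * g t := fun x => by
    refine (hwi0.const_mul (w x)).mono' (Continuous.aestronglyMeasurable (by fun_prop))
      (Filter.Eventually.of_forall fun t => ?_)
    rw [Real.norm_of_nonneg (mul_nonneg (by linarith [hw1 (x + t)]) (hg t))]
    exact hwle x t
  have hwθ : ∀ x, ∫ t, w (x + t) * g t ≤ w x * θ := fun x => by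
    rw [hθdef, ← integral_const_mul]
    exact integral_mono (hwi x) (hwi0.const_mul _) (hwle x)
  have hDw : ∀ x, D * (1 + |x|) ^ k ≤ D * R ^ k * w x := fun x => by
    rw [mul_assoc, hw, ← mul_pow]
    have : R * (1 + |x| / R) = R + |x| := by field_simp
    rw [this]
    gcongr
  set C := D * R ^ k / (1 - θ) with hCdef
  have hC0 : 0 < C := div_pos (by positivity) (by linarith)
  have hCθ : D * R ^ k = C - C * θ := by
    have : 1 - θ ≠ 0 := by linarith
    rw [hCdef]; field_simp
  set U : ℝ → ℝ := fun x => u x + C * w x with hU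
  set V : ℝ → ℝ := fun x => u x - C * w x with hV
  have hCw : ∀ x, 0 < C * w x := fun x => mul_pos hC0 (by linarith [hw1 x])
  have hUpos : ∀ x, 0 < U x := fun x => by simp only [hU]; linarith [hCw x, hu0 x]
  have huU : ∀ x, u x ≤ U x := fun x => by simp only [hU]; linarith [hCw x]
  have hVu : ∀ x, V x ≤ u x := fun x => by simp only [hV]; linarith [hCw x]
  have eU : ∀ x, (fun t => U (x + t) * g t) =
      fun t => u (x + t) * g t + C * (w (x + t) * g t) := fun x => by
    ext t; simp only [hU]; ring
  have eV : ∀ x, (fun t => V (x + t) * g t) =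
      fun t => u (x + t) * g t - C * (w (x + t) * g t) := fun x => by
    ext t; simp only [hV]; ring
  have hUi : ∀ x, Integrable fun t => U (x + t) * g t := fun x => by
    rw [eU]; exact (hui x).add ((hwi x).const_mul C)
  have hVi : ∀ x, Integrable fun t => V (x + t) * g t := fun x => by
    rw [eV]; exact (hui x).sub ((hwi x).const_mul C)
  have hUs : ∀ x, ∫ t, U (x + t) * g t ≤ U x := fun x => by
    rw [eU, integral_add (hui x) ((hwi x).const_mul C), integral_const_mul]
    have h1 := mul_le_mul_of_nonneg_left (hwθ x) hC0.le
    have h2 := hDw x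
    rw [hCθ] at h2
    simp only [hU]
    linarith [hsuper x]
  have hVs : ∀ x, V x ≤ ∫ t, V (x + t) * g t := fun x => by
    rw [eV, integral_sub (hui x) ((hwi x).const_mul C), integral_const_mul]
    have h1 := mul_le_mul_of_nonneg_left (hwθ x) hC0.le
    have h2 := hDw x
    rw [hCθ] at h2
    simp only [hV]
    linarith [hsub x]
  have hratio : ∀ x, V (x + a) / U x ≤ 1 / ∫ t in a..b, g t := fun x => by
    rw [div_le_div_iff₀ (hUpos x) hA, one_mul]
    have h1 : u (x + a) * ∫ t in a..b, g t ≤ ∫ t in Set.Ioc a b, U (x + t) * g t := by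
      rw [intervalIntegral.integral_of_le hab, ← integral_const_mul]
      refine setIntegral_mono_on (hgi.const_mul _).integrableOn (hUi x).integrableOn
        measurableSet_Ioc fun t ht => mul_le_mul_of_nonneg_right ?_ (hg t)
      exact (hu (by linarith [ht.1])).trans (huU _)
    have h2 := setIntegral_le_integral (s := Set.Ioc a b) (hUi x)
      (Filter.Eventually.of_forall fun t => mul_nonneg (hUpos _).le (hg t))
    have h3 := mul_le_mul_of_nonneg_right (hVu (x + a)) hA.le
    linarith [hUs x]
  have hbdd : BddAbove (Set.range fun x => V (x + a) / U x) :=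
    ⟨_, by rintro _ ⟨x, rfl⟩; exact hratio x⟩
  set r := ⨆ x, V (x + a) / U x with hr
  have hk : ∀ x, V (x + a) ≤ r * U x := fun x =>
    (div_le_iff₀ (hUpos x)).1 (le_ciSup hbdd x)
  rcases le_or_gt r 1 with hr1 | hr1
  · refine polynomial_growth_of_increment hu hu0 ha (C := 2 * C) (by positivity) k fun x hx => ?_
    have h1 := (hk x).trans (mul_le_of_le_one_left (hUpos x).le hr1)
    simp only [hU, hV] at h1
    have h2 : w (x + a) ≤ (1 + |x + a|) ^ k := by
      simp only [hw]
      have := div_le_self (abs_nonneg (x + a)) hR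
      gcongr
    have h3 : w x ≤ (1 + |x + a|) ^ k := by
      refine le_trans ?_ h2
      simp only [hw]
      rw [abs_of_nonneg hx, abs_of_nonneg (by linarith)]
      gcongr
      linarith
    have h4 := mul_le_mul_of_nonneg_left (add_le_add h2 h3) hC0.le
    linarith
  · exfalso
    set ρ := (1 + r) / 2 with hρdef
    have hρ : 1 < ρ := by linarith
    have hb0 : 0 < b := by linarith
    have hlog : 0 < Real.log ρ := Real.log_pos hρ
    have eK : ∀ x, (fun t => (r * U (x + t) - V (x + t + a)) * g t) =
        fun t => r * (U (x + t) * g t) - V (x + a + t) * g t := fun x => by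
      ext t; rw [add_right_comm x t a]; ring
    refine hexp (Real.log ρ / b) (by positivity) b ?_
    refine integrableOn_Ioi_of_intervalIntegral_norm_bounded (l := Filter.atTop)
      (b := fun J : ℕ => (J + 1) * b) ρ b (fun J => ?_) ?_ (Filter.Eventually.of_forall fun J => ?_)
    · exact (Continuous.integrableOn_Icc (by fun_prop)).mono_set Set.Ioc_subset_Icc_self
    · exact (Filter.tendsto_atTop_add_const_right _ 1 tendsto_natCast_atTop_atTop).atTop_mul_const
        hb0
    · obtain ⟨x, hx⟩ := exists_geometric_growth hg hgi hu huU hVu hUpos hab hA hA1 hρ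
        (by linarith : ρ < r) hk
        (fun x => by rw [eK]; exact ((hUi x).const_mul r).sub (hVi (x + a)))
        (fun x => by
          rw [eK, integral_sub ((hUi x).const_mul r) (hVi (x + a)), integral_const_mul]
          have := mul_le_mul_of_nonneg_left (hUs x) (by linarith : 0 ≤ r)
          linarith [hVs (x + a)])
        (fun ε hε => by
          obtain ⟨x, hx⟩ := exists_lt_of_lt_ciSup (show r - ε < r by linarith)
          exact ⟨x, (lt_div_iff₀ (hUpos x)).1 hx⟩) J
      have hbJ : b ≤ (J + 1) * b := le_mul_of_one_le_left hb0.le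
        (by linarith [J.cast_nonneg (α := ℝ)])
      have hpt : ∀ t ∈ Set.Ioc b ((J + 1) * b),
          ‖Real.exp (Real.log ρ / b * t) * g t‖ * U x ≤ ρ * (U (x + t) * g t) := by
        intro t ht
        rw [Real.norm_of_nonneg (mul_nonneg (Real.exp_pos _).le (hg t)), mul_right_comm,
          ← mul_assoc]
        refine mul_le_mul_of_nonneg_right ?_ (hg t)
        have ht0 : 0 ≤ t / b := div_nonneg (by linarith [ht.1]) hb0.le
        have hf1 : 1 ≤ ⌊t / b⌋₊ := by
          rw [Nat.one_le_floor_iff, le_div_iff₀ hb0]; linarith [ht.1]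
        have hfJ : ⌊t / b⌋₊ ≤ J + 1 := by
          have : t / b ≤ (J + 1 : ℕ) := by rw [div_le_iff₀ hb0]; push_cast; exact ht.2
          exact Nat.floor_le_of_le this
        obtain ⟨i, hi⟩ : ∃ i, ⌊t / b⌋₊ = i + 1 := ⟨_, (Nat.sub_add_cancel hf1).symm⟩
        have hfl := Nat.floor_le ht0
        have hlf := Nat.lt_floor_add_one (t / b)
        rw [hi] at hfl hlf
        push_cast at hfl hlf
        have h1 := hx i (by omega)
        have h2 : u (x + (i + 1) * b) ≤ U (x + t) := by
          refine (hu ?_).trans (huU _)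
          rw [le_div_iff₀ hb0] at hfl
          linarith
        have h3 : Real.exp (Real.log ρ / b * t) ≤ ρ * ρ ^ (i + 1) := by
          rw [← pow_succ', ← Real.exp_log (by linarith : 0 < ρ), ← Real.exp_nat_mul,
            Real.exp_log (by linarith : 0 < ρ)]
          refine Real.exp_le_exp.2 ?_
          rw [div_mul_eq_mul_div, mul_div_assoc, mul_comm]
          refine mul_le_mul_of_nonneg_right ?_ hlog.le
          push_cast
          linarith
        calc _ ≤ ρ * ρ ^ (i + 1) * U x := mul_le_mul_of_nonneg_right h3 (hUpos x).le
          _ = ρ * (ρ ^ (i + 1) * U x) := by ring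
          _ ≤ ρ * U (x + t) := by gcongr; exact h1.trans h2
      rw [intervalIntegral.integral_of_le hbJ]
      refine le_of_mul_le_mul_right ?_ (hUpos x)
      calc (∫ t in Set.Ioc b ((J + 1) * b), ‖Real.exp (Real.log ρ / b * t) * g t‖) * U x
          = ∫ t in Set.Ioc b ((J + 1) * b), ‖Real.exp (Real.log ρ / b * t) * g t‖ * U x :=
            (integral_mul_const _ _).symm
        _ ≤ ∫ t in Set.Ioc b ((J + 1) * b), ρ * (U (x + t) * g t) := by
            refine setIntegral_mono_on ?_ ((hUi x).const_mul ρ).integrableOn measurableSet_Ioc hpt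
            exact (Continuous.integrableOn_Icc (by fun_prop)).mono_set Set.Ioc_subset_Icc_self
        _ ≤ ∫ t, ρ * (U (x + t) * g t) :=
            setIntegral_le_integral ((hUi x).const_mul ρ) (Filter.Eventually.of_forall fun t =>
              mul_nonneg (by linarith) (mul_nonneg (hUpos _).le (hg t)))
        _ ≤ ρ * U x := by
            rw [integral_const_mul]
            exact mul_le_mul_of_nonneg_left (hUs x) (by linarith)

/-- If a nonnegative monotone function differs by a polynomially bounded amount from its mollification by
a nonnegative even band-limited Schwartz function, then it has polynomial growth. -/
theorem polynomial_growth_of_mollification (g : SchwartzMap ℝ ℝ) (hg : ∀ t, 0 ≤ g t)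
    (heven : ∀ t, g (-t) = g t) {B : ℝ}
    (hFT : ∀ ξ : ℝ, B < |ξ| → FT (fun t => (g t : ℂ)) ξ = 0)
    {u : ℝ → ℝ} (hu : Monotone u) (hu0 : ∀ x, 0 ≤ u x) {D : ℝ} (hD : 0 < D) (k : ℕ)
    (hbound : ∀ x, |u x - ∫ τ, u τ * g (x - τ)| ≤ D * (1 + |x|) ^ k) :
    ∃ C : ℝ, ∃ K : ℕ, ∀ x, u x ≤ C * (1 + |x|) ^ K := by
  simp only [integral_translate_of_even u g heven] at hbound
  have hint : ∀ k : ℕ, Integrable fun t => (1 + |t|) ^ k * g t := fun k => by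
    simpa [abs_of_nonneg (hg _)] using g.integrable_weight_mul k
  have hgi : Integrable g := by simpa using hint 0
  have habs : ∀ k : ℕ, Integrable fun t => |t| ^ k * g t := fun k => by
    simpa [abs_of_nonneg (hg _)] using g.integrable_pow_mul volume k
  by_cases hgood : ∀ x, Integrable fun t => u (x + t) * g t
  · have hnn : ∀ x, 0 ≤ ∫ t, u (x + t) * g t := fun x =>
      integral_nonneg fun t => mul_nonneg (hu0 _) (hg t)
    rcases lt_or_ge (∫ t, g t) 1 with hm | hm
    · rcases eq_or_ne (∫ t, g t) 0 with h0 | h0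
      · refine ⟨D, k, fun x => ?_⟩
        have hg0 : ∀ᵐ t, g t = 0 := (integral_eq_zero_iff_of_nonneg hg hgi).1 h0
        have : ∫ t, u (x + t) * g t = 0 := integral_eq_zero_of_ae (by
          filter_upwards [hg0] with t ht
          simp [ht])
        have hx := hbound x
        rw [this, sub_zero] at hx
        exact (le_abs_self _).trans hx
      · exact polynomial_growth_of_mass_lt_one hg g.continuous hint hm
          (fun a ha b h => h0 (integral_eq_zero_of_exp_moment hg heven g.continuous hgi hFT ha h))
          hu hu0 hgood hD k (fun x => by linarith [(abs_le.1 (hbound x)).1])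
          (fun x => by linarith [(abs_le.1 (hbound x)).2])
    · set m := ∫ t, g t with hmdef
      have hm0 : 0 < m := by linarith
      refine polynomial_growth_of_mass_one (g := fun t => g t / m) (fun t => div_nonneg (hg t) hm0.le)
        (fun t => by simp only [heven]) (fun k => ?_) ?_ hu hu0 (fun x => ?_) hD.le k (fun x => ?_)
      · simpa only [mul_div_assoc] using (habs k).div_const m
      · rw [integral_div, ← hmdef, div_self hm0.ne']
      · simpa only [mul_div_assoc] using (hgood x).div_const m
      · simp only [← mul_div_assoc]
        rw [integral_div]
        have := div_le_self (hnn x) hm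
        linarith [(abs_le.1 (hbound x)).1]
  · push Not at hgood
    obtain ⟨x₀, hx₀⟩ := hgood
    have hlarge : ∀ x, x₀ ≤ x → u x ≤ D * (1 + |x|) ^ k := fun x hx => by
      have hbad : ¬ Integrable fun t => u (x + t) * g t := fun h => hx₀ <| by
        refine h.mono' (((hu.measurable.comp (measurable_const_add x₀)).mul
          g.continuous.measurable).aestronglyMeasurable) (Filter.Eventually.of_forall fun t => ?_)
        rw [Real.norm_of_nonneg (mul_nonneg (hu0 _) (hg t))]
        exact mul_le_mul_of_nonneg_right (hu (by linarith)) (hg t)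
      have h := hbound x
      rw [integral_undef hbad, sub_zero] at h
      exact (le_abs_self _).trans h
    refine ⟨D + u x₀, k, fun x => ?_⟩
    have hone : (1 : ℝ) ≤ (1 + |x|) ^ k := one_le_pow₀ (by linarith [abs_nonneg x])
    have h1 := le_mul_of_one_le_right (hu0 x₀) hone
    rcases le_total x₀ x with h | h
    · linarith [hlarge x h, hu0 x₀]
    · have : 0 ≤ D * (1 + |x|) ^ k := by positivity
      linarith [hu h]

/-- If `φ ∗ g = g`, then `N - N ∗ φ = E - E ∗ φ` where `E = N - N ∗ g`. -/
theorem sub_mollification_eq {N φ g : ℝ → ℝ} (hN : Measurable N) {C : ℝ} (K : ℕ)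
    (hNb : ∀ x, |N x| ≤ C * (1 + |x|) ^ K) (hφc : Continuous φ) (hgc : Continuous g)
    (hφ : Integrable fun t => (1 + |t|) ^ K * |φ t|)
    (hg : Integrable fun t => (1 + |t|) ^ K * |g t|)
    (hφg : ∀ x, ∫ t, φ t * g (x - t) = g x) (l : ℝ) :
    N l - ∫ τ, N τ * φ (l - τ) = (N l - ∫ τ, N τ * g (l - τ))
      - ∫ σ, (N σ - ∫ τ, N τ * g (σ - τ)) * φ (l - σ) := by
  have hC : 0 ≤ C := by simpa using (abs_nonneg _).trans (hNb 0)
  have hw : ∀ x t : ℝ, (1 + |x + t|) ^ K ≤ (1 + |x|) ^ K * (1 + |t|) ^ K := fun x t => by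
    simpa using weight_add_le 1 one_pos K x t
  have hNφ : Integrable fun τ => N τ * φ (l - τ) := by
    refine ((hφ.comp_sub_left l).const_mul (C * (1 + |l|) ^ K)).mono'
      (hN.mul (by fun_prop)).aestronglyMeasurable (Filter.Eventually.of_forall fun τ => ?_)
    rw [norm_mul, Real.norm_eq_abs, Real.norm_eq_abs, ← mul_assoc, mul_assoc C]
    refine mul_le_mul_of_nonneg_right ((hNb τ).trans ?_) (abs_nonneg _)
    refine mul_le_mul_of_nonneg_left ?_ hC
    simpa [abs_sub_comm] using hw l (τ - l)
  have hprod : Integrable (fun p : ℝ × ℝ => N p.1 * g (p.2 - p.1) * φ (l - p.2))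
      (volume.prod volume) := by
    have h := ((hφ.comp_sub_left l).convolution_integrand (ContinuousLinearMap.mul ℝ ℝ)
      hg.comp_neg (μ := volume)).const_mul (C * (1 + |l|) ^ K)
    refine h.mono' (((hN.comp measurable_fst).mul (by fun_prop)).mul
      (by fun_prop)).aestronglyMeasurable (Filter.Eventually.of_forall fun p => ?_)
    obtain ⟨τ, σ⟩ := p
    simp only [ContinuousLinearMap.mul_apply', neg_sub, norm_mul, Real.norm_eq_abs]
    have h1 : (1 + |τ|) ^ K ≤ (1 + |l|) ^ K * (1 + |l - σ|) ^ K * (1 + |σ - τ|) ^ K := by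
      have e1 : (1 + |σ|) ^ K ≤ (1 + |l|) ^ K * (1 + |l - σ|) ^ K := by
        simpa [abs_sub_comm] using hw l (σ - l)
      have e2 : (1 + |τ|) ^ K ≤ (1 + |σ|) ^ K * (1 + |σ - τ|) ^ K := by
        simpa [abs_sub_comm] using hw σ (τ - σ)
      exact e2.trans (by gcongr)
    calc |N τ| * |g (σ - τ)| * |φ (l - σ)|
        ≤ C * ((1 + |l|) ^ K * (1 + |l - σ|) ^ K * (1 + |σ - τ|) ^ K)
          * |g (σ - τ)| * |φ (l - σ)| := by
          gcongr
          exact (hNb τ).trans (by gcongr)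
      _ = _ := by ring
  have hsecond : ∫ σ, (∫ τ, N τ * g (σ - τ)) * φ (l - σ) = ∫ τ, N τ * g (l - τ) := by
    calc ∫ σ, (∫ τ, N τ * g (σ - τ)) * φ (l - σ)
        = ∫ σ, ∫ τ, N τ * g (σ - τ) * φ (l - σ) := by simp only [integral_mul_const]
      _ = ∫ τ, ∫ σ, N τ * g (σ - τ) * φ (l - σ) := (integral_integral_swap hprod).symm
      _ = ∫ τ, N τ * g (l - τ) := by
          congr 1 with τ
          simp only [mul_assoc]
          rw [integral_const_mul, ← hφg (l - τ), ← integral_sub_left_eq_self _ volume l]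
          congr 2 with t
          rw [sub_sub_cancel, mul_comm, sub_right_comm]
  have hsecondi : Integrable fun σ => (∫ τ, N τ * g (σ - τ)) * φ (l - σ) := by
    simpa only [integral_mul_const] using hprod.integral_prod_right
  simp only [sub_mul]
  rw [integral_sub hNφ hsecondi, hsecond]
  ring

theorem dilated_weight_integral_le (ρ : SchwartzMap ℝ ℝ) (k : ℕ) {T : ℝ} (hT : 1 ≤ T) :
    (Integrable fun t => (1 + |t|) ^ k * |T * ρ (T * t)|) ∧
      ∫ t, (1 + |t|) ^ k * |T * ρ (T * t)| ≤ ∫ t, (1 + |t|) ^ k * |ρ t| := by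
  have hT0 : 0 < T := by linarith
  have hi := ρ.integrable_weight_mul k
  have hd : Integrable fun t => T * ((1 + |T * t|) ^ k * |ρ (T * t)|) :=
    (hi.comp_mul_left' hT0.ne').const_mul T
  have hle : ∀ t, (1 + |t|) ^ k * |T * ρ (T * t)| ≤ T * ((1 + |T * t|) ^ k * |ρ (T * t)|) := by
    intro t
    rw [abs_mul, abs_of_pos hT0, mul_left_comm]
    have : |t| ≤ |T * t| := by
      rw [abs_mul, abs_of_pos hT0]; exact le_mul_of_one_le_left (abs_nonneg t) hT
    gcongr
  have hi' : Integrable fun t => (1 + |t|) ^ k * |T * ρ (T * t)| := by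
    refine hd.mono' (Continuous.aestronglyMeasurable (by fun_prop))
      (Filter.Eventually.of_forall fun t => ?_)
    rw [Real.norm_of_nonneg (by positivity)]
    exact hle t
  refine ⟨hi', (integral_mono hi' hd hle).trans_eq ?_⟩
  rw [integral_const_mul, Measure.integral_comp_mul_left (fun t => (1 + |t|) ^ k * |ρ t|),
    abs_of_pos (inv_pos.2 hT0), smul_eq_mul, mul_inv_cancel_left₀ hT0.ne']

theorem rpow_weight_le {α : ℝ} (hα : 0 ≤ α) {k : ℕ} (hk : α ≤ k) (l σ : ℝ) :
    (1 + |σ|) ^ α ≤ (1 + |l|) ^ α * (1 + |l - σ|) ^ k := by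
  have h : 1 + |σ| ≤ (1 + |l|) * (1 + |l - σ|) := by
    have : |σ| ≤ |l| + |l - σ| := by
      have := abs_sub l (l - σ); simpa using this
    nlinarith [abs_nonneg l, abs_nonneg (l - σ)]
  calc (1 + |σ|) ^ α ≤ ((1 + |l|) * (1 + |l - σ|)) ^ α := by gcongr
    _ = (1 + |l|) ^ α * (1 + |l - σ|) ^ α := Real.mul_rpow (by positivity) (by positivity)
    _ ≤ (1 + |l|) ^ α * (1 + |l - σ|) ^ (k : ℝ) := by
        gcongr
        linarith [abs_nonneg (l - σ)]
    _ = _ := by rw [Real.rpow_natCast]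

/-- Transfer of the Tauberian bound from the auxiliary mollifiers `ρ̃_T` to
`ρ_T`: if `|N − N ∗ ρ̃_T|` satisfies the two-term bound and `ρ_T ∗ ρ̃_T = ρ̃_T`,
then `|N − N ∗ ρ_T|` satisfies the same bound with a new constant. -/
theorem stmt_19 (ρ : SchwartzMap ℝ ℝ) (heven : ∀ t, ρ (-t) = ρ t)
    (hsupp : ∀ ξ : ℝ, 1 < |ξ| → FT (fun t => (ρ t : ℂ)) ξ = 0)
    (hone : ∀ ξ : ℝ, |ξ| < 1/2 → FT (fun t => (ρ t : ℂ)) ξ = 1)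
    (N : ℝ → ℝ) (hmono : Monotone N) (hNsupp : ∀ l : ℝ, l < 0 → N l = 0)
    (c₁ c : ℝ) (hc₁ : 0 < c₁) (hc : 0 < c) (d : ℕ) (hd : 1 ≤ d)
    (ρt : ℝ → SchwartzMap ℝ ℝ)
    (hρt : ∀ T : ℝ, 1 ≤ T →
      (∀ t, 0 ≤ ρt T t) ∧ (∀ t, ρt T (-t) = ρt T t) ∧
      (∀ ξ : ℝ, T / 2 < |ξ| → FT (fun t => (ρt T t : ℂ)) ξ = 0) ∧
      (∀ x : ℝ, (∫ t : ℝ, (T * ρ (T * t)) * ρt T (x - t)) = ρt T x) ∧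
      (∀ l : ℝ, |N l - ∫ τ : ℝ, N τ * ρt T (l - τ)|
        ≤ c / T * (1 + |l|) ^ ((d : ℝ) - 1)
          + Real.exp (c * T) * (1 + |l|) ^ (((d : ℝ) - 1) / 2))) :
    ∃ c' > (0:ℝ), ∀ T : ℝ, 1 ≤ T → ∀ l : ℝ,
      |N l - ∫ τ : ℝ, N τ * (T * ρ (T * (l - τ)))|
        ≤ c' / T * (1 + |l|) ^ ((d : ℝ) - 1)
          + Real.exp (c' * T) * (1 + |l|) ^ (((d : ℝ) - 1) / 2) := by
  have hN0 : ∀ x, 0 ≤ N x := fun x => by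
    rw [← hNsupp (min x 0 - 1) (by linarith [min_le_right x 0])]
    exact hmono (by linarith [min_le_left x 0])
  have hd1 : (1 : ℝ) ≤ d := by exact_mod_cast hd
  have hpow : ∀ α : ℝ, α ≤ d → ∀ x : ℝ, (1 + |x|) ^ α ≤ (1 + |x|) ^ d := fun α hα x => by
    rw [← Real.rpow_natCast]
    exact Real.rpow_le_rpow_of_exponent_le (by linarith [abs_nonneg x]) hα
  obtain ⟨C, K, hCK⟩ : ∃ C : ℝ, ∃ K : ℕ, ∀ x, N x ≤ C * (1 + |x|) ^ K := by
    obtain ⟨h1, h2, h3, -, h5⟩ := hρt 1 le_rfl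
    refine polynomial_growth_of_mollification (ρt 1) h1 h2 h3 hmono hN0
      (D := c + Real.exp c) (by positivity) d fun x => (h5 x).trans ?_
    rw [div_one, mul_one, add_mul]
    gcongr
    · exact hpow _ (by linarith) x
    · exact hpow _ (by linarith) x
  set I := ∫ t, (1 + |t|) ^ d * |ρ t| with hI
  have hI0 : 0 ≤ I := integral_nonneg fun t => by positivity
  refine ⟨(1 + I) * c + I, by positivity, fun T hT l => ?_⟩
  obtain ⟨-, -, -, h4, h5⟩ := hρt T hT
  have hT0 : 0 < T := by linarith
  obtain ⟨hdi, hdle⟩ := dilated_weight_integral_le ρ d hT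
  set P := c / T * (1 + |l|) ^ ((d : ℝ) - 1)
    + Real.exp (c * T) * (1 + |l|) ^ (((d : ℝ) - 1) / 2) with hP
  have hP0 : 0 ≤ P := by positivity
  have hE : ∀ σ, |N σ - ∫ τ, N τ * ρt T (σ - τ)| ≤ P * (1 + |l - σ|) ^ d := fun σ => by
    refine (h5 σ).trans ?_
    rw [hP, add_mul, mul_assoc, mul_assoc]
    gcongr
    · exact rpow_weight_le (by linarith) (by linarith) l σ
    · exact rpow_weight_le (by linarith) (by linarith) l σ
  have hconv : |∫ σ, (N σ - ∫ τ, N τ * ρt T (σ - τ)) * (T * ρ (T * (l - σ)))| ≤ P * I := by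
    calc _ ≤ ∫ σ, P * ((1 + |l - σ|) ^ d * |T * ρ (T * (l - σ))|) := by
          rw [← Real.norm_eq_abs]
          refine norm_integral_le_of_norm_le ((hdi.comp_sub_left l).const_mul P)
            (Filter.Eventually.of_forall fun σ => ?_)
          rw [norm_mul, Real.norm_eq_abs, Real.norm_eq_abs, ← mul_assoc]
          exact mul_le_mul_of_nonneg_right (hE σ) (abs_nonneg _)
      _ = P * ∫ t, (1 + |t|) ^ d * |T * ρ (T * t)| := by
          rw [integral_const_mul,
            integral_sub_left_eq_self (fun t => (1 + |t|) ^ d * |T * ρ (T * t)|) volume l]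
      _ ≤ _ := by gcongr
  rw [sub_mollification_eq (φ := fun t => T * ρ (T * t)) (g := ρt T) hmono.measurable K
    (fun x => (abs_of_nonneg (hN0 x)).trans_le (hCK x)) (by fun_prop) (ρt T).continuous
    (dilated_weight_integral_le ρ K hT).1 ((ρt T).integrable_weight_mul K) h4 l]
  refine (abs_sub _ _).trans ((add_le_add (h5 l) hconv).trans ?_)
  have hexp : (1 + I) * Real.exp (c * T) ≤ Real.exp (((1 + I) * c + I) * T) := by
    calc (1 + I) * Real.exp (c * T) ≤ Real.exp I * Real.exp (c * T) := by
          gcongr; linarith [Real.add_one_le_exp I]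
      _ = Real.exp (I + c * T) := (Real.exp_add _ _).symm
      _ ≤ _ := by
          refine Real.exp_le_exp.2 ?_
          have : 0 ≤ I * c * T := by positivity
          nlinarith
  calc P + P * I = (1 + I) * c / T * (1 + |l|) ^ ((d : ℝ) - 1)
        + (1 + I) * Real.exp (c * T) * (1 + |l|) ^ (((d : ℝ) - 1) / 2) := by rw [hP]; ring
    _ ≤ _ := by
        gcongr
        linarith
end
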